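/- Let d ≥ 1. There exist constants α > 0 and N_d, depending only on d, with the following property. Let f : ℝ^{1+d} → [0,∞) be Borel measurable with ∫_{C_2} f^{d+1} dt dx < ∞ and f = 0 outside C_2. Then there exists a bounded nonpositive function z : [0,∞) × B_4 → ℝ such that: (a) for each t ≥ 0 the map x ↦ z(t,x) is convex on B_4, and for each x ∈ B_4 the map t ↦ z(t,x) is nondecreasing; (b) for every space–time mollifier ξ, every ε ∈ (0,2), every symmetric positive semidefinite d×d real matrix a = (a^{ij}), and every (t,x) ∈ C_2 one has ∂_t z^{(ε)}(t,x) + ∑_{i,j} a^{ij} D_{ij} z^{(ε)}(t,x) ≥ α (det a)^{1/(d+1)} f^{(ε)}(t,x), where the convolutions u^{(ε)} = u * ξ_ε at points of C_2 only involve values of z and f on [0,∞) × B_4 since supp ξ ⊆ (−1,0) × B_1; (c) |z(t,x)| ≤ N_d (∫_{C_2} f^{d+1} dt dx)^{1/(d+1)} for all (t,x) ∈ [0,∞) × B_4. -/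

import Mathlib

open MeasureTheory Metric

/-- Space–time mollification `u⁽ᵉ⁾ = u * ξ_ε` where
`ξ_ε(t,x) = ε^{-d-1} ξ(t/ε, x/ε)`. -/
noncomputable def stMollify {d : ℕ} (ξ : ℝ × EuclideanSpace ℝ (Fin d) → ℝ) (ε : ℝ)
    (u : ℝ × EuclideanSpace ℝ (Fin d) → ℝ) (q : ℝ × EuclideanSpace ℝ (Fin d)) : ℝ :=
  ∫ r : ℝ × EuclideanSpace ℝ (Fin d),
    u (q - r) * ((ε ^ (d + 1))⁻¹ * ξ (ε⁻¹ * r.1, ε⁻¹ • r.2))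



lemma minkowski_aux {d : ℕ} (hd : 1 ≤ d) (S : Matrix (Fin d) (Fin d) ℝ) (hS : S.det ≠ 0) :
    ∃ B : Fin d → Fin d → ℤ, (Matrix.of B).det ≠ 0 ∧
      ∏ i, ‖WithLp.toLp 2 (S.mulVec (fun j => (B i j : ℝ)))‖ ≤ (2 * d) ^ d * |S.det| := by
  classical
  have hd0 : (0 : ℝ) < d := by exact_mod_cast hd
  by_contra hcon
  push Not at hcon
  let nm : (Fin d → ℤ) → ℝ := fun l => ‖WithLp.toLp 2 (S.mulVec (fun j => (l j : ℝ)))‖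
  let T : Set ℝ := {r | ∃ B : Fin d → Fin d → ℤ, (Matrix.of B).det ≠ 0 ∧ ∏ i, nm (B i) = r}
  have hTne : T.Nonempty := by
    refine ⟨_, fun i j => if i = j then 1 else 0, ?_, rfl⟩
    have : (Matrix.of fun i j : Fin d => if i = j then (1 : ℤ) else 0) = 1 := by
      ext i j; simp [Matrix.one_apply]
    rw [this]; simp
  have hC0 : 0 < (2 * d : ℝ) ^ d * |S.det| := by positivity
  have hTb : ∀ r ∈ T, (2 * d : ℝ) ^ d * |S.det| < r := by
    rintro r ⟨B, hB, rfl⟩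
    exact hcon B hB
  have hbdd : BddBelow T := ⟨_, fun r hr => (hTb r hr).le⟩
  have hI0 : 0 < sInf T := hC0.trans_le (le_csInf hTne fun r hr => (hTb r hr).le)
  obtain ⟨P, ⟨B₀, hB₀, hP⟩, hPlt⟩ := exists_lt_of_csInf_lt hTne (show sInf T < 2 * sInf T by linarith)
  -- sort
  let σ := Tuple.sort fun i => nm (B₀ i)
  let B : Fin d → Fin d → ℤ := fun i => B₀ (σ i)
  have hmono : Monotone fun i => nm (B i) := Tuple.monotone_sort fun i => nm (B₀ i)
  have hBP : ∏ i, nm (B i) = P := by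
    rw [← hP]; exact Equiv.prod_comp σ fun i => nm (B₀ i)
  have hB : (Matrix.of B).det ≠ 0 := by
    have : Matrix.of B = (Matrix.of B₀).submatrix σ id := rfl
    rw [this, Matrix.det_permute]
    refine mul_ne_zero ?_ hB₀
    rcases Int.units_eq_one_or (Equiv.Perm.sign σ) with h | h <;> simp [h]
  have hPpos : 0 < ∏ i, nm (B i) := by
    rw [hBP, ← hP]; exact hC0.trans (hcon B₀ hB₀)
  have hnm0 : ∀ l, 0 ≤ nm l := fun l => norm_nonneg _
  have hnmpos : ∀ i, 0 < nm (B i) := fun i =>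
    lt_of_le_of_ne (hnm0 _) fun h => hPpos.ne' (Finset.prod_eq_zero (Finset.mem_univ i) h.symm)
  set A : Matrix (Fin d) (Fin d) ℝ := (Matrix.of B).map (fun n : ℤ => (n : ℝ)) with hA
  have hcast : ∀ X : Matrix (Fin d) (Fin d) ℤ, (X.map (fun n : ℤ => (n : ℝ))).det = ((X.det : ℤ) : ℝ) :=
    fun X => (RingHom.map_det (Int.castRingHom ℝ) X).symm
  have hAdet : A.det ≠ 0 := by rw [hA, hcast]; exact_mod_cast hB
  have hAu : IsUnit A.det := isUnit_iff_ne_zero.2 hAdet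
  -- replacement
  have hrep : ∀ (v : Fin d → ℤ) (i : Fin d),
      (Matrix.vecMul (fun j => (v j : ℝ)) A⁻¹) i ≠ 0 → nm (B i) / 2 < nm v := by
    intro v i hi
    set c := Matrix.vecMul (fun j => (v j : ℝ)) A⁻¹ with hc
    have hv : (fun j => (v j : ℝ)) = ∑ k, c k • A k := by
      have : Matrix.vecMul c A = fun j => (v j : ℝ) := by
        rw [hc, Matrix.vecMul_vecMul, Matrix.nonsing_inv_mul _ hAu, Matrix.vecMul_one]
      rw [← this]
      ext j
      simp [Matrix.vecMul, dotProduct]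
    have hdet : ((Matrix.of B).updateRow i v).det ≠ 0 := by
      have h1 : ((Matrix.of B).updateRow i v).map (fun n : ℤ => (n : ℝ)) =
          A.updateRow i (∑ k, c k • A k) := by
        rw [← hv, hA]
        ext a b
        by_cases h : a = i
        · subst h; simp
        · simp [h]
      have h2 := hcast ((Matrix.of B).updateRow i v)
      rw [h1, Matrix.det_updateRow_sum] at h2
      intro h0
      rw [h0] at h2
      simp only [Int.cast_zero, smul_eq_mul, mul_eq_zero] at h2
      exact h2.elim hi hAdet
    have hmem : ∏ k, nm (Function.update B i v k) ∈ T := ⟨Function.update B i v, hdet, rfl⟩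
    have hle := csInf_le hbdd hmem
    have e1 : ∏ k, nm (Function.update B i v k) = nm v * ∏ k ∈ Finset.univ.erase i, nm (B k) := by
      rw [← Finset.mul_prod_erase _ _ (Finset.mem_univ i)]
      congr 1
      · simp
      · refine Finset.prod_congr rfl fun k hk => ?_
        rw [Function.update_of_ne (Finset.ne_of_mem_erase hk)]
    have e2 : ∏ k, nm (B k) = nm (B i) * ∏ k ∈ Finset.univ.erase i, nm (B k) :=
      (Finset.mul_prod_erase _ _ (Finset.mem_univ i)).symm
    have hpe : 0 < ∏ k ∈ Finset.univ.erase i, nm (B k) := Finset.prod_pos fun k _ => hnmpos k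
    have : nm (B i) * ∏ k ∈ Finset.univ.erase i, nm (B k) <
        (2 * nm v) * ∏ k ∈ Finset.univ.erase i, nm (B k) := by
      rw [← e2, hBP, mul_assoc, ← e1]
      linarith
    have := lt_of_mul_lt_mul_right this hpe.le
    linarith
  -- orthonormal frame
  let vec : (Fin d → ℝ) → EuclideanSpace ℝ (Fin d) := fun x => WithLp.toLp 2 (S.mulVec x)
  let b : OrthonormalBasis (Fin d) ℝ (EuclideanSpace ℝ (Fin d)) :=
    InnerProductSpace.gramSchmidtOrthonormalBasis (by simp) fun i => vec (A i)
  have htri : ∀ i j, i < j → inner ℝ (b j) (vec (A i)) = 0 := fun i j hij =>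
    InnerProductSpace.gramSchmidtOrthonormalBasis_inv_triangular _ _ hij
  let O : Matrix (Fin d) (Fin d) ℝ := Matrix.of fun j k => b j k
  have hO : O * O.transpose = 1 := by
    ext j l
    have := b.inner_eq_ite j l
    rw [PiLp.inner_apply] at this
    simp only [Matrix.mul_apply, Matrix.transpose_apply, O, Matrix.of_apply, Matrix.one_apply]
    rw [← this]
    refine Finset.sum_congr rfl fun k _ => ?_
    simp [mul_comm]
  have hOdet : |O.det| = 1 := by
    have := congrArg Matrix.det hO
    rw [Matrix.det_mul, Matrix.det_transpose, Matrix.det_one, ← sq] at this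
    have h2 : |O.det| ^ 2 = 1 := by rw [sq_abs, this]
    nlinarith [abs_nonneg O.det]
  have hOS : ∀ x j, ((O * S).mulVec x) j = inner ℝ (b j) (vec x) := by
    intro x j
    rw [← Matrix.mulVec_mulVec, PiLp.inner_apply]
    simp only [Matrix.mulVec, dotProduct, O, Matrix.of_apply, vec]
    refine Finset.sum_congr rfl fun k _ => ?_
    simp [mul_comm]
  let s : Set (Fin d → ℝ) := (Matrix.toLin' (O * S)) ⁻¹'
    (Set.pi Set.univ fun j => Set.Icc (-(nm (B j) / (2 * d))) (nm (B j) / (2 * d)))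
  have hmem_s : ∀ x, x ∈ s ↔ ∀ j, |inner ℝ (b j) (vec x)| ≤ nm (B j) / (2 * d) := by
    intro x
    simp only [s, Set.mem_preimage, Set.mem_univ_pi, Matrix.toLin'_apply, hOS, Set.mem_Icc, abs_le]
  have hsymm : ∀ x ∈ s, -x ∈ s := by
    intro x hx
    rw [hmem_s] at hx ⊢
    intro j
    have : vec (-x) = - vec x := by
      simp only [vec, Matrix.mulVec_neg]; rfl
    rw [this, inner_neg_right, abs_neg]
    exact hx j
  have hconv : Convex ℝ s :=
    (convex_pi fun j _ => convex_Icc _ _).linear_preimage _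
  have hdetne : LinearMap.det (Matrix.toLin' (O * S)) ≠ 0 := by
    rw [LinearMap.det_toLin', Matrix.det_mul]
    refine mul_ne_zero (fun h => ?_) hS
    rw [h] at hOdet; simp at hOdet
  have hvol : volume s = ENNReal.ofReal (|S.det|⁻¹ * ∏ j, (nm (B j) / d)) := by
    simp only [s]
    rw [Measure.addHaar_preimage_linearMap _ hdetne, LinearMap.det_toLin', volume_pi_pi,
      ENNReal.ofReal_mul (by positivity), ENNReal.ofReal_prod_of_nonneg
        fun j _ => div_nonneg (hnm0 _) hd0.le]
    congr 1
    · rw [abs_inv, Matrix.det_mul, abs_mul, hOdet, one_mul]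
    · refine Finset.prod_congr rfl fun j _ => ?_
      rw [Real.volume_Icc]
      congr 1
      field_simp
      ring
  have hbig : volume (ZSpan.fundamentalDomain (Pi.basisFun ℝ (Fin d))) *
      2 ^ Module.finrank ℝ (Fin d → ℝ) < volume s := by
    rw [ZSpan.fundamentalDomain_pi_basisFun, volume_pi_pi, hvol]
    simp only [Real.volume_Ico, sub_zero, ENNReal.ofReal_one, Finset.prod_const_one, one_mul,
      Module.finrank_fin_fun]
    rw [show (2 : ENNReal) ^ d = ENNReal.ofReal (2 ^ d) by
      rw [ENNReal.ofReal_pow (by norm_num)]; simp]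
    rw [ENNReal.ofReal_lt_ofReal_iff']
    have : (2 : ℝ) ^ d < |S.det|⁻¹ * ∏ j, (nm (B j) / d) := by
      rw [Finset.prod_div_distrib, Finset.prod_const, Finset.card_univ, Fintype.card_fin]
      have h := hcon B hB
      have hSp : 0 < |S.det| := abs_pos.2 hS
      rw [inv_mul_eq_div, lt_div_iff₀ hSp, lt_div_iff₀ (by positivity)]
      rw [mul_pow] at h
      simp only [nm]
      linarith
    exact ⟨this, lt_trans (by positivity) this⟩
  have hcount : Countable
      (Submodule.span ℤ (Set.range (Pi.basisFun ℝ (Fin d)))).toAddSubgroup :=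
    inferInstanceAs (Countable (Submodule.span ℤ (Set.range (Pi.basisFun ℝ (Fin d)))))
  obtain ⟨⟨x, hxL⟩, hx0, hxs⟩ := exists_ne_zero_mem_lattice_of_measure_mul_two_pow_lt_measure
    (L := (Submodule.span ℤ (Set.range (Pi.basisFun ℝ (Fin d)))).toAddSubgroup)
    (ZSpan.isAddFundamentalDomain (Pi.basisFun ℝ (Fin d)) volume) hsymm hconv hbig
  have hxi : ∀ i, ∃ n : ℤ, (n : ℝ) = x i := by
    have := ((Pi.basisFun ℝ (Fin d)).mem_span_iff_repr_mem ℤ x).1 hxL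
    simpa using this
  choose v hv using hxi
  have hxv : x = fun j => (v j : ℝ) := funext fun j => (hv j).symm
  have hxne : x ≠ 0 := fun h => hx0 (by ext1; exact h)
  have hxs : x ∈ s := hxs
  set c := Matrix.vecMul x A⁻¹ with hc
  have hcA : Matrix.vecMul c A = x := by
    rw [hc, Matrix.vecMul_vecMul, Matrix.nonsing_inv_mul _ hAu, Matrix.vecMul_one]
  have hcne : (Finset.univ.filter fun i => c i ≠ 0).Nonempty := by
    by_contra h
    rw [Finset.not_nonempty_iff_eq_empty, Finset.filter_eq_empty_iff] at h
    have : c = 0 := funext fun i => by simpa using h (Finset.mem_univ i)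
    rw [this, Matrix.zero_vecMul] at hcA
    exact hxne hcA.symm
  set k := (Finset.univ.filter fun i => c i ≠ 0).max' hcne with hk
  have hck : c k ≠ 0 := (Finset.mem_filter.1 (Finset.max'_mem _ hcne)).2
  have hcgt : ∀ i, k < i → c i = 0 := by
    intro i hi
    by_contra h
    exact absurd (Finset.le_max' _ i (Finset.mem_filter.2 ⟨Finset.mem_univ i, h⟩)) (not_le.2 hi)
  have hlow : nm (B k) / 2 < nm v := hrep v k (by rw [← hxv]; exact hck)
  have hvecx : vec x = ∑ i, c i • vec (A i) := by
    have h1 : x = ∑ i, c i • A i := by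
      rw [← hcA]; ext j; simp [Matrix.vecMul, dotProduct]
    have h2 : vec x = WithLp.toLp 2 ((Matrix.toLin' S) x) := rfl
    rw [h2, h1, map_sum, WithLp.toLp_sum]
    refine Finset.sum_congr rfl fun i _ => ?_
    rw [map_smul]; rfl
  have hz : ∀ j, k < j → inner ℝ (b j) (vec x) = 0 := by
    intro j hj
    rw [hvecx, inner_sum]
    refine Finset.sum_eq_zero fun i _ => ?_
    rw [inner_smul_right]
    by_cases hi : k < i
    · rw [hcgt i hi, zero_mul]
    · rw [htri i j ((not_lt.1 hi).trans_lt hj), mul_zero]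
  have hnorm : (nm v) ^ 2 = ∑ j, (inner ℝ (b j) (vec x)) ^ 2 := by
    have h1 := b.sum_sq_norm_inner_right (vec x)
    have h2 : nm v = ‖vec x‖ := by simp only [nm, vec, hxv]
    rw [h2, ← h1]
    simp
  have hup : (nm v) ^ 2 ≤ ∑ j : Fin d, (nm (B k) / (2 * d)) ^ 2 := by
    rw [hnorm]
    refine Finset.sum_le_sum fun j _ => ?_
    by_cases hj : k < j
    · rw [hz j hj, zero_pow two_ne_zero]; positivity
    · have h1 := (hmem_s x).1 hxs j
      have h2 : nm (B j) ≤ nm (B k) := hmono (not_lt.1 hj)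
      rw [← sq_abs (inner ℝ (b j) (vec x))]
      gcongr
      exact h1.trans (by gcongr)
  have hup2 : ∑ j : Fin d, (nm (B k) / (2 * d)) ^ 2 ≤ (nm (B k) / 2) ^ 2 := by
    simp only [Finset.sum_const, Finset.card_univ, Fintype.card_fin, nsmul_eq_mul]
    have hd1 : (1 : ℝ) ≤ d := by exact_mod_cast hd
    have : (d : ℝ) * (nm (B k) / (2 * d)) ^ 2 = (nm (B k) / 2) ^ 2 / d := by field_simp
    rw [this]
    exact div_le_self (sq_nonneg _) hd1
  have : nm v ≤ nm (B k) / 2 := abs_le_of_sq_le_sq' (hup.trans hup2) (by linarith [hnmpos k]) |>.2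
  linarith


lemma psd_decomp {d : ℕ} (a : Matrix (Fin d) (Fin d) ℝ) (ha : a.PosSemidef) :
    ∃ T : Matrix (Fin d) (Fin d) ℝ, a = T.transpose * T := by
  open scoped MatrixOrder in
  obtain ⟨T, hT⟩ := CStarAlgebra.nonneg_iff_eq_star_mul_self.1 (Matrix.nonneg_iff_posSemidef.2 ha)
  exact ⟨T, by rw [hT, Matrix.star_eq_conjTranspose, Matrix.conjTranspose_eq_transpose_of_trivial]⟩

lemma psd_pair {d : ℕ} (T : Matrix (Fin d) (Fin d) ℝ)
    (H : Fin d → Fin d → ℝ) (hH : ∀ v : Fin d → ℝ, 0 ≤ ∑ i, ∑ j, v i * v j * H i j) :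
    0 ≤ ∑ i, ∑ j, (T.transpose * T) i j * H i j := by
  have : ∑ i, ∑ j, (T.transpose * T) i j * H i j = ∑ k, ∑ i, ∑ j, T k i * T k j * H i j := by
    rw [Finset.sum_comm]
    simp only [Matrix.mul_apply, Matrix.transpose_apply, Finset.sum_mul]
    rw [Finset.sum_comm]
    calc _ = ∑ i, ∑ k, ∑ j, T k i * T k j * H i j :=
          Finset.sum_congr rfl fun i _ => Finset.sum_comm
      _ = _ := Finset.sum_comm
  rw [this]
  exact Finset.sum_nonneg fun k _ => hH (T k)

lemma psd_pair' {d : ℕ} (a : Matrix (Fin d) (Fin d) ℝ) (ha : a.PosSemidef)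
    (H : Fin d → Fin d → ℝ) (hH : ∀ v : Fin d → ℝ, 0 ≤ ∑ i, ∑ j, v i * v j * H i j) :
    0 ≤ ∑ i, ∑ j, a i j * H i j := by
  obtain ⟨T, rfl⟩ := psd_decomp a ha
  exact psd_pair T H hH

lemma lattice_minor (d : ℕ) (hd : 1 ≤ d) : ∃ c : ℝ, 0 < c ∧
    ∀ a : Matrix (Fin d) (Fin d) ℝ, a.PosSemidef → a.det ≠ 0 →
      ∃ (B : Fin d → Fin d → ℤ) (lam : Fin d → ℝ), (Matrix.of B).det ≠ 0 ∧ (∀ i, 0 < lam i) ∧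
        c * a.det ≤ ∏ i, lam i ∧
        ∀ H : Fin d → Fin d → ℝ, (∀ v : Fin d → ℝ, 0 ≤ ∑ i, ∑ j, v i * v j * H i j) →
          ∑ i, lam i * (∑ j, ∑ k, (B i j : ℝ) * (B i k : ℝ) * H j k) ≤ ∑ i, ∑ j, a i j * H i j := by
  have hd0 : (0 : ℝ) < d := by exact_mod_cast hd
  refine ⟨((d : ℝ) ^ d * (((2 * d : ℝ)) ^ d) ^ 2)⁻¹, by positivity, fun a ha hdet => ?_⟩
  obtain ⟨T, hT⟩ := psd_decomp a ha
  have hdT : a.det = T.det ^ 2 := by rw [hT, Matrix.det_mul, Matrix.det_transpose, sq]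
  have hT0 : T.det ≠ 0 := fun h => hdet (by rw [hdT, h]; simp)
  have hTu : IsUnit T.det := isUnit_iff_ne_zero.2 hT0
  have hS : (T⁻¹).transpose.det ≠ 0 := by
    rw [Matrix.det_transpose, Matrix.det_nonsing_inv]
    simpa using hT0
  obtain ⟨B, hB, hprod⟩ := minkowski_aux hd (T⁻¹).transpose hS
  set S := (T⁻¹).transpose with hSdef
  set L : Fin d → EuclideanSpace ℝ (Fin d) :=
    fun i => WithLp.toLp 2 (S.mulVec (fun j => (B i j : ℝ))) with hL
  have hLB : ∀ i (v : Fin d → ℝ), ∑ j, (B i j : ℝ) * v j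
      = inner ℝ (L i) (WithLp.toLp 2 (T.mulVec v)) := by
    intro i v
    have h1 : inner ℝ (L i) (WithLp.toLp 2 (T.mulVec v)) =
        dotProduct (S.mulVec (fun j => (B i j : ℝ))) (T.mulVec v) := by
      rw [PiLp.inner_apply, dotProduct]
      refine Finset.sum_congr rfl fun k _ => ?_
      simp [L, mul_comm]
    rw [h1, Matrix.dotProduct_mulVec, hSdef, Matrix.mulVec_transpose, Matrix.vecMul_vecMul,
      Matrix.nonsing_inv_mul _ hTu, Matrix.vecMul_one]
    rfl
  have hL0 : ∀ i, L i ≠ 0 := by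
    intro i h
    have h2 : ∀ j, B i j = 0 := by
      intro j
      have := hLB i (Pi.single j 1)
      rw [h, inner_zero_left] at this
      simpa [Pi.single_apply] using this
    exact hB (Matrix.det_eq_zero_of_row_eq_zero i h2)
  have hLp : ∀ i, 0 < ‖L i‖ := fun i => norm_pos_iff.2 (hL0 i)
  refine ⟨B, fun i => (d * ‖L i‖ ^ 2)⁻¹, hB, fun i => ?_, ?_, ?_⟩
  · have := hLp i
    positivity
  · rw [Finset.prod_inv_distrib, Finset.prod_mul_distrib, Finset.prod_const, Finset.card_univ,
      Fintype.card_fin, Finset.prod_pow]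
    have hP : 0 < ∏ i, ‖L i‖ := Finset.prod_pos fun i _ => hLp i
    have h3 : (∏ i, ‖L i‖) ^ 2 ≤ ((2 * d : ℝ) ^ d) ^ 2 * (a.det)⁻¹ := by
      have h4 : S.det ^ 2 = (a.det)⁻¹ := by
        rw [hSdef, Matrix.det_transpose, Matrix.det_nonsing_inv, hdT]
        simp
      rw [← h4, ← sq_abs S.det, ← mul_pow]
      exact pow_le_pow_left₀ hP.le hprod 2
    have hdp : 0 < a.det := by rw [hdT]; positivity
    rw [mul_comm, ← div_eq_mul_inv, div_le_iff₀ (by positivity), mul_inv,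
      ]
    rw [← div_eq_mul_inv, le_div_iff₀ hdp] at h3
    have : ((d : ℝ) ^ d)⁻¹ * ((∏ i, ‖L i‖) ^ 2)⁻¹ * ((d : ℝ) ^ d * ((2 * d : ℝ) ^ d) ^ 2)
        = ((2 * d : ℝ) ^ d) ^ 2 / (∏ i, ‖L i‖) ^ 2 := by
      field_simp
    rw [this, le_div_iff₀ (by positivity)]
    linarith
  · intro H hH
    have hpsd : (a - ∑ i, (d * ‖L i‖ ^ 2)⁻¹ • Matrix.of fun j k => (B i j : ℝ) * (B i k : ℝ)).PosSemidef := by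
      refine Matrix.PosSemidef.of_dotProduct_mulVec_nonneg ?_ ?_
      · refine Matrix.IsHermitian.sub ha.1 ?_
        ext j k
        simp only [Matrix.conjTranspose_apply, Matrix.sum_apply, star_trivial, Matrix.smul_apply,
          Matrix.of_apply]
        refine Finset.sum_congr rfl fun i _ => ?_
        rw [mul_comm (B i k : ℝ)]
      · intro v
        rw [star_trivial, Matrix.sub_mulVec, dotProduct_sub, sub_nonneg]
        have h1 : dotProduct v (a.mulVec v) = ‖(WithLp.toLp 2 (T.mulVec v) : EuclideanSpace ℝ (Fin d))‖ ^ 2 := by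
          rw [EuclideanSpace.norm_sq_eq, hT, ← Matrix.mulVec_mulVec, Matrix.dotProduct_mulVec,
            Matrix.vecMul_transpose]
          simp [dotProduct, sq]
        rw [h1, Matrix.sum_mulVec, dotProduct_sum]
        have h2 : ∀ i, dotProduct v (((d * ‖L i‖ ^ 2)⁻¹ •
            Matrix.of fun j k => (B i j : ℝ) * (B i k : ℝ)).mulVec v)
            = (d * ‖L i‖ ^ 2)⁻¹ * (∑ j, (B i j : ℝ) * v j) ^ 2 := by
          intro i
          rw [Matrix.smul_mulVec, dotProduct_smul, smul_eq_mul]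
          congr 1
          rw [sq, Finset.sum_mul_sum]
          simp only [dotProduct, Matrix.mulVec, Matrix.of_apply, Finset.mul_sum]
          refine Finset.sum_congr rfl fun j _ => Finset.sum_congr rfl fun k _ => by ring
        simp only [h2]
        calc _ ≤ ∑ i : Fin d, (d : ℝ)⁻¹ * ‖(WithLp.toLp 2 (T.mulVec v) : EuclideanSpace ℝ (Fin d))‖ ^ 2 := by
              refine Finset.sum_le_sum fun i _ => ?_
              rw [hLB]
              have h5 := real_inner_mul_inner_self_le (L i) (WithLp.toLp 2 (T.mulVec v))
              rw [real_inner_self_eq_norm_sq, real_inner_self_eq_norm_sq, ← sq] at h5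
              have := hLp i
              rw [mul_inv, mul_assoc]
              gcongr
              rw [inv_mul_le_iff₀ (by positivity)]
              exact h5
          _ = _ := by
              simp; field_simp
    have h := psd_pair' _ hpsd H hH
    simp only [Matrix.sub_apply, Matrix.sum_apply, Matrix.smul_apply, Matrix.of_apply, sub_mul,
      Finset.sum_sub_distrib, sub_nonneg, smul_eq_mul, Finset.sum_mul] at h
    refine le_trans (le_of_eq ?_) h
    simp only [Finset.mul_sum]
    rw [Finset.sum_comm]
    refine Finset.sum_congr rfl fun j _ => ?_
    rw [Finset.sum_comm]
    refine Finset.sum_congr rfl fun k _ => ?_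
    refine Finset.sum_congr rfl fun i _ => ?_
    ring

/-- Second difference on the integer lattice. -/
def latD2 {d : ℕ} (z : (Fin d → ℤ) → ℝ) (x l : Fin d → ℤ) : ℝ := z (x + l) + z (x - l) - 2 * z x

/-- Discrete subsolutions of the parabolic Monge–Ampère scheme. -/
structure LatSub {d : ℕ} (N : ℕ) (I : Finset (Fin d → ℤ)) (Bs : Finset (Fin d → Fin d → ℤ))
    (g : ℕ → (Fin d → ℤ) → ℝ) (z : ℕ → (Fin d → ℤ) → ℝ) : Prop where
  nonpos : ∀ n x, z n x ≤ 0
  zero : ∀ n x, ¬ (n < N ∧ x ∈ I) → z n x = 0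
  mono : ∀ n x, z n x ≤ z (n + 1) x
  conv : ∀ n, n < N → ∀ x ∈ I, ∀ B ∈ Bs, ∀ i, 0 ≤ latD2 (z n) x (B i)
  prod : ∀ n, n < N → ∀ x ∈ I, ∀ B ∈ Bs,
    g n x ≤ (z (n + 1) x - z n x) * ∏ i, latD2 (z n) x (B i)

lemma latSub_nonempty {d : ℕ} (N : ℕ) (I J : Finset (Fin d → ℤ)) (Bs : Finset (Fin d → Fin d → ℤ))
    (g : ℕ → (Fin d → ℤ) → ℝ) (hg : ∀ n x, 0 ≤ g n x)
    (hIJ : ∀ x ∈ I, x ∈ J) (hB0 : ∀ B ∈ Bs, ∀ i, B i ≠ 0)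
    (hJ : ∀ x ∈ I, ∀ B ∈ Bs, ∀ i, x + B i ∈ J ∧ x - B i ∈ J) :
    ∃ z, LatSub N I Bs g z := by
  classical
  set K : ℝ := 1 + ∑ n ∈ Finset.range N, ∑ x ∈ I, g n x with hK
  have hK1 : 1 ≤ K := by
    have : 0 ≤ ∑ n ∈ Finset.range N, ∑ x ∈ I, g n x :=
      Finset.sum_nonneg fun n _ => Finset.sum_nonneg fun x _ => hg n x
    linarith
  have hgK : ∀ n, n < N → ∀ x ∈ I, g n x ≤ K := by
    intro n hn x hx
    have h1 : g n x ≤ ∑ x ∈ I, g n x := Finset.single_le_sum (fun x _ => hg n x) hx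
    have h2 : ∑ x ∈ I, g n x ≤ ∑ n ∈ Finset.range N, ∑ x ∈ I, g n x :=
      Finset.single_le_sum (f := fun n => ∑ x ∈ I, g n x)
        (fun n _ => Finset.sum_nonneg fun x _ => hg n x) (Finset.mem_range.2 hn)
    linarith
  let sq : (Fin d → ℤ) → ℝ := fun y => ∑ j, (y j : ℝ) ^ 2
  have hsq0 : ∀ y, 0 ≤ sq y := fun y => Finset.sum_nonneg fun j _ => sq_nonneg _
  set R : ℝ := ∑ y ∈ J, sq y with hR
  have hsqR : ∀ y ∈ J, sq y ≤ R := fun y hy => Finset.single_le_sum (fun y _ => hsq0 y) hy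
  let P : ℕ → (Fin d → ℤ) → ℝ := fun n y => K * (sq y - R) - K * ((N : ℝ) - n)
  let z : ℕ → (Fin d → ℤ) → ℝ := fun n y => if n < N ∧ y ∈ I then P n y else 0
  have hP0 : ∀ n, n ≤ N → ∀ y ∈ J, P n y ≤ 0 := by
    intro n hn y hy
    have h1 := hsqR y hy
    have h2 : (n : ℝ) ≤ N := by exact_mod_cast hn
    simp only [P]
    nlinarith
  have hzP : ∀ n, n ≤ N → ∀ y ∈ J, P n y ≤ z n y := by
    intro n hn y hy
    simp only [z]
    split_ifs
    · exact le_rfl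
    · exact hP0 n hn y hy
  have hd2 : ∀ n, n < N → ∀ x ∈ I, ∀ B ∈ Bs, ∀ i, 1 ≤ latD2 (z n) x (B i) := by
    intro n hn x hx B hB i
    have e : z n x = P n x := by simp [z, hn, hx]
    have h1 := hzP n hn.le _ (hJ x hx B hB i).1
    have h2 := hzP n hn.le _ (hJ x hx B hB i).2
    have h3 : sq (x + B i) + sq (x - B i) - 2 * sq x = 2 * sq (B i) := by
      simp only [sq, Finset.mul_sum, ← Finset.sum_add_distrib, ← Finset.sum_sub_distrib]
      refine Finset.sum_congr rfl fun j _ => ?_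
      simp; ring
    have h4 : 1 ≤ sq (B i) := by
      obtain ⟨j, hj⟩ := Function.ne_iff.1 (hB0 B hB i)
      have : (1 : ℝ) ≤ (B i j : ℝ) ^ 2 := by
        have : (1 : ℤ) ≤ (B i j) ^ 2 := by
          have : 0 < (B i j) ^ 2 := by
            have : B i j ≠ 0 := hj
            positivity
          omega
        exact_mod_cast this
      exact this.trans (Finset.single_le_sum (f := fun j => (B i j : ℝ) ^ 2)
        (fun j _ => sq_nonneg _) (Finset.mem_univ j))
    simp only [latD2, e]
    have h5 : P n (x + B i) + P n (x - B i) - 2 * P n x = K * (2 * sq (B i)) := by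
      rw [← h3]; simp only [P]; ring
    nlinarith
  have hdt : ∀ n, n < N → ∀ x ∈ I, K ≤ z (n + 1) x - z n x := by
    intro n hn x hx
    have e : z n x = P n x := by simp [z, hn, hx]
    have h1 := hzP (n + 1) hn _ (hIJ x hx)
    have : P (n + 1) x - P n x = K := by simp only [P]; push_cast; ring
    linarith
  refine ⟨z, ?_, ?_, ?_, ?_, ?_⟩
  · intro n x
    simp only [z]
    split_ifs with h
    · exact hP0 n h.1.le x (hIJ x h.2)
    · exact le_rfl
  · intro n x h
    simp only [z, if_neg h]
  · intro n x
    by_cases h : n < N ∧ x ∈ I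
    · have := hdt n h.1 x h.2
      linarith
    · have h' : ¬ (n + 1 < N ∧ x ∈ I) := fun h' => h ⟨by omega, h'.2⟩
      simp only [z, if_neg h, if_neg h']; exact le_rfl
  · intro n hn x hx B hB i
    linarith [hd2 n hn x hx B hB i]
  · intro n hn x hx B hB
    have h1 : 1 ≤ ∏ i, latD2 (z n) x (B i) := by
      have := Finset.prod_le_prod (s := Finset.univ) (f := fun _ : Fin d => (1 : ℝ))
        (g := fun i => latD2 (z n) x (B i)) (fun _ _ => zero_le_one) fun i _ => hd2 n hn x hx B hB i
      simpa using this
    have h2 := hdt n hn x hx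
    have h3 := hgK n hn x hx
    nlinarith

lemma lat_perron {d : ℕ} (N : ℕ) (I J : Finset (Fin d → ℤ)) (Bs : Finset (Fin d → Fin d → ℤ))
    (g : ℕ → (Fin d → ℤ) → ℝ) (hg : ∀ n x, 0 ≤ g n x)
    (hIJ : ∀ x ∈ I, x ∈ J) (hB0 : ∀ B ∈ Bs, ∀ i, B i ≠ 0)
    (hJ : ∀ x ∈ I, ∀ B ∈ Bs, ∀ i, x + B i ∈ J ∧ x - B i ∈ J) :
    ∃ z, LatSub N I Bs g z ∧ ∀ n, n < N → ∀ x ∈ I, z (n + 1) x ≠ z n x →  ∃ B ∈ Bs,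
      (z (n + 1) x - z n x) * ∏ i, latD2 (z n) x (B i) = g n x := by
  classical
  obtain ⟨z0, hz0⟩ := latSub_nonempty N I J Bs g hg hIJ hB0 hJ
  let S : Set (ℕ → (Fin d → ℤ) → ℝ) := {z | LatSub N I Bs g z}
  have : Nonempty S := ⟨⟨z0, hz0⟩⟩
  let Z : ℕ → (Fin d → ℤ) → ℝ := fun n x => ⨆ w : S, w.1 n x
  have hbdd : ∀ n x, BddAbove (Set.range fun w : S => w.1 n x) := by
    intro n x
    refine ⟨0, ?_⟩
    rintro _ ⟨w, rfl⟩
    exact w.2.nonpos n x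
  have hle : ∀ w, LatSub N I Bs g w → ∀ n x, w n x ≤ Z n x := fun w hw n x =>
    le_ciSup (hbdd n x) ⟨w, hw⟩
  have happ : ∀ n x, ∀ e > 0, ∃ w, LatSub N I Bs g w ∧ Z n x - e < w n x := by
    intro n x e he
    obtain ⟨w, hw⟩ := exists_lt_of_lt_ciSup (show Z n x - e < ⨆ w : S, w.1 n x by
      simp only [Z]; linarith)
    exact ⟨w.1, w.2, hw⟩
  have hZ : LatSub N I Bs g Z := by
    refine ⟨?_, ?_, ?_, ?_, ?_⟩
    · intro n x
      exact ciSup_le fun w => w.2.nonpos n x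
    · intro n x h
      have : ∀ w : S, w.1 n x = 0 := fun w => w.2.zero n x h
      simp only [Z, this, ciSup_const]
    · intro n x
      exact ciSup_le fun w => (w.2.mono n x).trans (hle w.1 w.2 _ _)
    · intro n hn x hx B hB i
      refine le_of_forall_pos_le_add fun e he => ?_
      obtain ⟨w, hw, h⟩ := happ n x (e / 2) (by positivity)
      have h1 := hw.conv n hn x hx B hB i
      have h2 := hle w hw n (x + B i)
      have h3 := hle w hw n (x - B i)
      simp only [latD2] at h1 ⊢
      linarith
    · intro n hn x hx B hB
      have hcont : Filter.Tendsto (fun e : ℝ => (Z (n + 1) x - Z n x + e) *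
          ∏ i, (latD2 (Z n) x (B i) + 2 * e)) (nhdsWithin 0 (Set.Ioi 0))
          (nhds ((Z (n + 1) x - Z n x) * ∏ i, latD2 (Z n) x (B i))) := by
        have : Continuous (fun e : ℝ => (Z (n + 1) x - Z n x + e) *
          ∏ i, (latD2 (Z n) x (B i) + 2 * e)) := by fun_prop
        have h := (this.tendsto 0).mono_left (nhdsWithin_le_nhds (s := Set.Ioi 0))
        simpa using h
      refine ge_of_tendsto hcont ?_
      filter_upwards [self_mem_nhdsWithin] with e he
      obtain ⟨w, hw, h⟩ := happ n x e he
      refine (hw.prod n hn x hx B hB).trans ?_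
      have h1 := hw.mono n x
      have h2 := hle w hw (n + 1) x
      have h3 : ∏ i, latD2 (w n) x (B i) ≤ ∏ i, (latD2 (Z n) x (B i) + 2 * e) := by
        refine Finset.prod_le_prod (fun i _ => hw.conv n hn x hx B hB i) fun i _ => ?_
        have h2 := hle w hw n (x + B i)
        have h3 := hle w hw n (x - B i)
        simp only [latD2]
        linarith
      refine mul_le_mul (by linarith) h3
        (Finset.prod_nonneg fun i _ => hw.conv n hn x hx B hB i) (by linarith)
  refine ⟨Z, hZ, ?_⟩
  intro n hn x hx hne
  by_contra hcon
  push Not at hcon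
  have hdt : 0 < Z (n + 1) x - Z n x := by
    have := lt_of_le_of_ne (hZ.mono n x) (Ne.symm hne)
    linarith
  have hlt : ∀ B ∈ Bs, g n x < (Z (n + 1) x - Z n x) * ∏ i, latD2 (Z n) x (B i) := fun B hB =>
    lt_of_le_of_ne (hZ.prod n hn x hx B hB) (Ne.symm (hcon B hB))
  have hpos : ∀ B ∈ Bs, ∀ i, 0 < latD2 (Z n) x (B i) := by
    intro B hB i
    refine lt_of_le_of_ne (hZ.conv n hn x hx B hB i) fun h0 => ?_
    have := hlt B hB
    rw [Finset.prod_eq_zero (Finset.mem_univ i) h0.symm, mul_zero] at this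
    linarith [hg n x]
  have hev : ∀ᶠ e in nhdsWithin (0 : ℝ) (Set.Ioi 0), e < Z (n + 1) x - Z n x ∧
      ∀ B ∈ Bs, (∀ i, 0 < latD2 (Z n) x (B i) - 2 * e) ∧
        g n x < (Z (n + 1) x - Z n x - e) * ∏ i, (latD2 (Z n) x (B i) - 2 * e) := by
    refine Filter.Eventually.filter_mono nhdsWithin_le_nhds ?_
    refine (eventually_lt_nhds hdt).and ?_
    rw [Filter.eventually_all_finset]
    intro B hB
    refine Filter.Eventually.and ?_ ?_
    · rw [Filter.eventually_all]
      intro i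
      have : Continuous fun e : ℝ => latD2 (Z n) x (B i) - 2 * e := by fun_prop
      exact (this.tendsto 0).eventually_const_lt (by simpa using hpos B hB i)
    · have : Continuous fun e : ℝ =>
        (Z (n + 1) x - Z n x - e) * ∏ i, (latD2 (Z n) x (B i) - 2 * e) := by fun_prop
      exact (this.tendsto 0).eventually_const_lt (by simpa using hlt B hB)
  obtain ⟨e, ⟨he1, he2⟩, he0⟩ := (hev.and self_mem_nhdsWithin).exists
  have he0 : 0 < e := he0
  let W : ℕ → (Fin d → ℤ) → ℝ := fun m y => if m = n ∧ y = x then Z n x + e else Z m y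
  have hWZ : ∀ m y, Z m y ≤ W m y := by
    intro m y
    simp only [W]
    split_ifs with h
    · rw [h.1, h.2]; linarith
    · exact le_rfl
  have hWx : W n x = Z n x + e := by simp [W]
  have hWo : ∀ m y, ¬ (m = n ∧ y = x) → W m y = Z m y := fun m y h => by simp only [W, if_neg h]
  have hd2o : ∀ m y, ¬ (m = n ∧ y = x) → ∀ l, latD2 (Z m) y l ≤ latD2 (W m) y l := by
    intro m y h l
    simp only [latD2, hWo m y h]
    linarith [hWZ m (y + l), hWZ m (y - l)]
  have hd2x : ∀ l, latD2 (Z n) x l - 2 * e ≤ latD2 (W n) x l := by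
    intro l
    simp only [latD2, hWx]
    linarith [hWZ n (x + l), hWZ n (x - l)]
  have hWn1 : W (n + 1) x = Z (n + 1) x := hWo _ _ (by simp)
  have hW : LatSub N I Bs g W := by
    refine ⟨?_, ?_, ?_, ?_, ?_⟩
    · intro m y
      by_cases h : m = n ∧ y = x
      · rw [h.1, h.2, hWx]
        linarith [hZ.nonpos (n + 1) x]
      · rw [hWo m y h]; exact hZ.nonpos m y
    · intro m y h
      rw [hWo m y (fun h' => h (by rw [h'.1, h'.2]; exact ⟨hn, hx⟩))]
      exact hZ.zero m y h
    · intro m y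
      by_cases h : m = n ∧ y = x
      · rw [h.1, h.2, hWx, hWn1]; linarith
      · rw [hWo m y h]; exact (hZ.mono m y).trans (hWZ _ _)
    · intro m hm y hy B hB i
      by_cases h : m = n ∧ y = x
      · rw [h.1, h.2]
        linarith [hd2x (B i), (he2 B hB).1 i]
      · exact (hZ.conv m hm y hy B hB i).trans (hd2o m y h _)
    · intro m hm y hy B hB
      by_cases h : m = n ∧ y = x
      · rw [h.1, h.2, hWx, hWn1]
        refine (he2 B hB).2.le.trans ?_
        rw [sub_sub]
        refine mul_le_mul_of_nonneg_left ?_ (by linarith)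
        exact Finset.prod_le_prod (fun i _ => ((he2 B hB).1 i).le) fun i _ => hd2x _
      · refine (hZ.prod m hm y hy B hB).trans ?_
        rw [hWo m y h]
        refine mul_le_mul (by linarith [hWZ (m + 1) y]) ?_
          (Finset.prod_nonneg fun i _ => hZ.conv m hm y hy B hB i)
          (by linarith [hWZ (m + 1) y, hZ.mono m y])
        exact Finset.prod_le_prod (fun i _ => hZ.conv m hm y hy B hB i) fun i _ => hd2o m y h _
  have := hle W hW n x
  rw [hWx] at this
  linarith


lemma lat_vol {d : ℕ} (B : Fin d → Fin d → ℤ) (hB : (Matrix.of B).det ≠ 0) (lo w : Fin d → ℝ)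
    (hw : ∀ i, 0 ≤ w i) :
    volume {p : Fin d → ℝ | ∀ i, lo i ≤ ∑ j, p j * (B i j : ℝ) ∧ ∑ j, p j * (B i j : ℝ) ≤ lo i + w i}
      ≤ ENNReal.ofReal (∏ i, w i) := by
  set A : Matrix (Fin d) (Fin d) ℝ := (Matrix.of B).map (fun n : ℤ => (n : ℝ)) with hA
  have hdet : A.det = (((Matrix.of B).det : ℤ) : ℝ) := by
    rw [hA]
    exact (RingHom.map_det (Int.castRingHom ℝ) (Matrix.of B)).symm
  have h1 : 1 ≤ |A.det| := by
    rw [hdet]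
    exact_mod_cast Int.one_le_abs hB
  have hne : LinearMap.det (Matrix.toLin' A) ≠ 0 := by
    rw [LinearMap.det_toLin']
    intro h; rw [h] at h1; norm_num at h1
  have hset : {p : Fin d → ℝ | ∀ i, lo i ≤ ∑ j, p j * (B i j : ℝ) ∧
      ∑ j, p j * (B i j : ℝ) ≤ lo i + w i} =
      (Matrix.toLin' A) ⁻¹' (Set.pi Set.univ fun i => Set.Icc (lo i) (lo i + w i)) := by
    ext p
    simp only [Set.mem_ofPred_eq, Set.mem_preimage, Set.mem_univ_pi, Set.mem_Icc]
    have : ∀ i, (Matrix.toLin' A) p i = ∑ j, p j * (B i j : ℝ) := by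
      intro i
      simp [Matrix.toLin'_apply, Matrix.mulVec, dotProduct, hA, mul_comm]
    simp only [this]
  rw [hset, Measure.addHaar_preimage_linearMap _ hne, LinearMap.det_toLin', volume_pi_pi,
    ENNReal.ofReal_prod_of_nonneg fun i _ => hw i]
  simp only [Real.volume_Icc, add_sub_cancel_left]
  refine mul_le_of_le_one_left zero_le ?_
  rw [ENNReal.ofReal_le_one, abs_inv]
  exact inv_le_one_of_one_le₀ h1

lemma lat_estimate {d : ℕ} (hd : 1 ≤ d) (N : ℕ) (I J : Finset (Fin d → ℤ))
    (Bs : Finset (Fin d → Fin d → ℤ))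
    (g : ℕ → (Fin d → ℤ) → ℝ) (hg : ∀ n x, 0 ≤ g n x)
    (hIJ : ∀ x ∈ I, x ∈ J) (hBdet : ∀ B ∈ Bs, (Matrix.of B).det ≠ 0)
    (hJ : ∀ x ∈ I, ∀ B ∈ Bs, ∀ i, x + B i ∈ J ∧ x - B i ∈ J)
    (ρ : ℝ) (hρ : 0 < ρ) (hJρ : ∀ y ∈ J, ∀ i, |(y i : ℝ)| ≤ ρ)
    (z : ℕ → (Fin d → ℤ) → ℝ) (hz : LatSub N I Bs g z)
    (htight : ∀ n, n < N → ∀ x ∈ I, z (n + 1) x ≠ z n x →  ∃ B ∈ Bs,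
      (z (n + 1) x - z n x) * ∏ i, latD2 (z n) x (B i) = g n x)
    (n₀ : ℕ) (x₀ : Fin d → ℤ) :
    (- z n₀ x₀) ^ (d + 1) ≤ 2 * (2 * d * ρ) ^ d * ∑ n ∈ Finset.range N, ∑ x ∈ I, g n x := by
  classical
  have hS0 : 0 ≤ ∑ n ∈ Finset.range N, ∑ x ∈ I, g n x :=
      Finset.sum_nonneg fun n _ => Finset.sum_nonneg fun x _ => hg n x
  have hd0 : (0 : ℝ) < d := by exact_mod_cast hd
  by_cases hin : ¬ (n₀ < N ∧ x₀ ∈ I)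
  · rw [hz.zero _ _ hin]
    simp only [neg_zero, ne_eq, Nat.add_eq_zero_iff, one_ne_zero, and_false, not_false_eq_true,
      zero_pow]
    positivity
  push Not at hin
  obtain ⟨hn₀, hx₀⟩ := hin
  set M : ℝ := - z n₀ x₀ with hM
  have hM0 : 0 ≤ M := by have := hz.nonpos n₀ x₀; linarith
  set c : ℝ := M / (4 * d * ρ) with hc
  have hc0 : 0 ≤ c := by positivity
  let pd : (Fin d → ℝ) → (Fin d → ℤ) → ℝ := fun p y => ∑ j, p j * (y j : ℝ)
  let Q : Set (Fin d → ℝ) := Set.pi Set.univ fun _ => Set.Icc (-c) c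
  have hpd : ∀ p ∈ Q, ∀ y ∈ J, |pd p y| ≤ M / 4 := by
    intro p hp y hy
    calc |pd p y| ≤ ∑ j, |p j * (y j : ℝ)| := Finset.abs_sum_le_sum_abs _ _
      _ ≤ ∑ j : Fin d, c * ρ := by
        refine Finset.sum_le_sum fun j _ => ?_
        rw [abs_mul]
        exact mul_le_mul (abs_le.2 (hp j (Set.mem_univ j))) (hJρ y hy j) (abs_nonneg _) hc0
      _ = M / 4 := by
        simp only [Finset.sum_const, Finset.card_univ, Fintype.card_fin, nsmul_eq_mul, hc]
        field_simp
  let NN : ℕ → (Fin d → ℤ) → Set (Fin d → ℝ) := fun n x =>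
    {p | ∀ y ∈ J, z n x - pd p x ≤ z n y - pd p y}
  have hNNm : ∀ n x, MeasurableSet (NN n x) := by
    intro n x
    have : NN n x = ⋂ y ∈ J, {p | z n x - pd p x ≤ z n y - pd p y} := by
      ext p; simp [NN]
    rw [this]
    refine Finset.measurableSet_biInter _ fun y _ => measurableSet_le ?_ ?_ <;>
      · simp only [pd]; fun_prop
  have hdt0 : ∀ n x, 0 ≤ z (n + 1) x - z n x := fun n x => sub_nonneg.2 (hz.mono n x)
  -- pointwise inequality
  have hpt : ∀ p ∈ Q, M / 2 ≤ ∑ n ∈ Finset.range N, ∑ x ∈ I,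
      (z (n + 1) x - z n x) * (NN n x).indicator (fun _ => (1 : ℝ)) p := by
    intro p hp
    have hJne : J.Nonempty := ⟨x₀, hIJ x₀ hx₀⟩
    let m : ℕ → ℝ := fun n => J.inf' hJne fun y => z n y - pd p y
    have hstep : ∀ n, n < N → m (n + 1) - m n ≤ ∑ x ∈ I,
        (z (n + 1) x - z n x) * (NN n x).indicator (fun _ => (1 : ℝ)) p := by
      intro n hn
      have hnn : ∀ x ∈ I, 0 ≤ (z (n + 1) x - z n x) * (NN n x).indicator (fun _ => (1 : ℝ)) p :=
        fun x _ => mul_nonneg (hdt0 n x) (Set.indicator_nonneg (fun _ _ => zero_le_one) _)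
      obtain ⟨y, hy, hym⟩ := J.exists_mem_eq_inf' hJne fun y => z n y - pd p y
      have h1 : m (n + 1) ≤ z (n + 1) y - pd p y :=
        Finset.inf'_le (f := fun y => z (n + 1) y - pd p y) hy
      have h2 : m n = z n y - pd p y := hym
      by_cases hyI : y ∈ I
      · have hmem : p ∈ NN n y := by
          intro y' hy'
          rw [← h2]
          exact Finset.inf'_le (f := fun y => z n y - pd p y) hy'
        have h3 := Finset.single_le_sum hnn hyI
        rw [Set.indicator_of_mem hmem, mul_one] at h3
        linarith
      · have e1 := hz.zero n y (fun h => hyI h.2)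
        have e2 := hz.zero (n + 1) y (fun h => hyI h.2)
        have := Finset.sum_nonneg hnn
        linarith
    have hmono : m 0 ≤ m n₀ := by
      have : Monotone m := monotone_nat_of_le_succ fun n => by
        refine Finset.le_inf' _ _ fun y hy => ?_
        exact (Finset.inf'_le (f := fun y => z n y - pd p y) hy).trans
          (by have := hz.mono n y; linarith)
      exact this (Nat.zero_le _)
    have htel : m N - m 0 ≤ ∑ n ∈ Finset.range N, ∑ x ∈ I,
        (z (n + 1) x - z n x) * (NN n x).indicator (fun _ => (1 : ℝ)) p := by
      rw [← Finset.sum_range_sub]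
      exact Finset.sum_le_sum fun n hn => hstep n (Finset.mem_range.1 hn)
    have hmn : m n₀ ≤ -M + M / 4 := by
      have h1 : m n₀ ≤ z n₀ x₀ - pd p x₀ :=
        Finset.inf'_le (f := fun y => z n₀ y - pd p y) (hIJ x₀ hx₀)
      have := abs_le.1 (hpd p hp x₀ (hIJ x₀ hx₀))
      linarith [this.1]
    have hmN : - (M / 4) ≤ m N := by
      refine Finset.le_inf' _ _ fun y hy => ?_
      have := abs_le.1 (hpd p hp y hy)
      rw [hz.zero N y (by simp)]
      linarith [this.2]
    linarith
  -- volume bound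
  have hvol : ∀ n, n < N → ∀ x ∈ I,
      ENNReal.ofReal (z (n + 1) x - z n x) * volume (NN n x) ≤ ENNReal.ofReal (g n x) := by
    intro n hn x hx
    by_cases hne : z (n + 1) x = z n x
    · simp [hne]
    obtain ⟨B, hB, hBg⟩ := htight n hn x hx hne
    have hsub : NN n x ⊆ {p : Fin d → ℝ | ∀ i,
        z n x - z n (x - B i) ≤ ∑ j, p j * (B i j : ℝ) ∧
        ∑ j, p j * (B i j : ℝ) ≤ z n x - z n (x - B i) + latD2 (z n) x (B i)} := by
      intro p hp i
      have h1 := hp _ (hJ x hx B hB i).1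
      have h2 := hp _ (hJ x hx B hB i).2
      have e1 : pd p (x + B i) = pd p x + ∑ j, p j * (B i j : ℝ) := by
        simp only [pd, ← Finset.sum_add_distrib]
        refine Finset.sum_congr rfl fun j _ => ?_
        simp; ring
      have e2 : pd p (x - B i) = pd p x - ∑ j, p j * (B i j : ℝ) := by
        simp only [pd, ← Finset.sum_sub_distrib]
        refine Finset.sum_congr rfl fun j _ => ?_
        simp; ring
      rw [e1] at h1
      rw [e2] at h2
      simp only [latD2]
      constructor <;> linarith
    calc _ ≤ ENNReal.ofReal (z (n + 1) x - z n x) *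
          ENNReal.ofReal (∏ i, latD2 (z n) x (B i)) := by
          gcongr
          exact (measure_mono hsub).trans
            (lat_vol B (hBdet B hB) _ _ fun i => hz.conv n hn x hx B hB i)
      _ = ENNReal.ofReal (g n x) := by
          rw [← ENNReal.ofReal_mul (hdt0 n x), hBg]
  have hQm : MeasurableSet Q := MeasurableSet.univ_pi fun _ => measurableSet_Icc
  have hQvol : volume Q = ENNReal.ofReal ((2 * c) ^ d) := by
    simp only [Q]
    rw [volume_pi_pi]
    simp only [Real.volume_Icc, Finset.prod_const, Finset.card_univ, Fintype.card_fin]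
    rw [← ENNReal.ofReal_pow (by linarith)]
    congr 2
    ring
  have h_intg : ENNReal.ofReal (M / 2) * volume Q ≤
      ENNReal.ofReal (∑ n ∈ Finset.range N, ∑ x ∈ I, g n x) := by
    calc ENNReal.ofReal (M / 2) * volume Q = ∫⁻ p in Q, ENNReal.ofReal (M / 2) := by simp
      _ ≤ ∫⁻ p in Q, ∑ n ∈ Finset.range N, ∑ x ∈ I,
          ENNReal.ofReal (z (n + 1) x - z n x) * (NN n x).indicator (fun _ => 1) p := by
          refine setLIntegral_mono' hQm fun p hp => ?_
          refine (ENNReal.ofReal_le_ofReal (hpt p hp)).trans ?_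
          rw [ENNReal.ofReal_sum_of_nonneg]
          swap
          · intro n _
            exact Finset.sum_nonneg fun x _ => mul_nonneg (hdt0 n x)
              (Set.indicator_nonneg (fun _ _ => zero_le_one) _)
          refine Finset.sum_le_sum fun n _ => ?_
          rw [ENNReal.ofReal_sum_of_nonneg]
          swap
          · intro x _
            exact mul_nonneg (hdt0 n x)
              (Set.indicator_nonneg (fun _ _ => zero_le_one) _)
          refine Finset.sum_le_sum fun x _ => ?_
          rw [ENNReal.ofReal_mul (hdt0 n x)]
          by_cases hpn : p ∈ NN n x <;> simp [hpn]
      _ ≤ ∫⁻ p, ∑ n ∈ Finset.range N, ∑ x ∈ I,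
          ENNReal.ofReal (z (n + 1) x - z n x) * (NN n x).indicator (fun _ => 1) p :=
          setLIntegral_le_lintegral _ _
      _ = ∑ n ∈ Finset.range N, ∑ x ∈ I,
          ENNReal.ofReal (z (n + 1) x - z n x) * volume (NN n x) := by
          rw [lintegral_finsetSum]
          swap
          · intro n _
            refine Finset.measurable_sum _ fun x _ => ?_
            exact (measurable_const.indicator (hNNm n x)).const_mul _
          refine Finset.sum_congr rfl fun n _ => ?_
          rw [lintegral_finsetSum]
          swap
          · intro x _
            exact (measurable_const.indicator (hNNm n x)).const_mul _
          refine Finset.sum_congr rfl fun x _ => ?_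
          rw [lintegral_const_mul _ (measurable_const.indicator (hNNm n x)),
            lintegral_indicator (hNNm n x)]
          simp
      _ ≤ ∑ n ∈ Finset.range N, ∑ x ∈ I, ENNReal.ofReal (g n x) :=
          Finset.sum_le_sum fun n hn => Finset.sum_le_sum fun x hx =>
            hvol n (Finset.mem_range.1 hn) x hx
      _ = _ := by
          rw [ENNReal.ofReal_sum_of_nonneg fun n _ => Finset.sum_nonneg fun x _ => hg n x]
          refine Finset.sum_congr rfl fun n _ => ?_
          rw [ENNReal.ofReal_sum_of_nonneg fun x _ => hg n x]
  rw [hQvol, ← ENNReal.ofReal_mul (by positivity), ENNReal.ofReal_le_ofReal_iff hS0] at h_intg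
  have e : M ^ (d + 1) = 2 * (2 * d * ρ) ^ d * (M / 2 * (2 * c) ^ d) := by
    have : 2 * d * ρ * (2 * c) = M := by rw [hc]; field_simp; ring
    calc M ^ (d + 1) = M * M ^ d := by ring
      _ = M * (2 * d * ρ * (2 * c)) ^ d := by rw [this]
      _ = _ := by rw [mul_pow (2 * d * ρ)]; ring
  rw [e]
  gcongr


/-- Index of the grid cell of mesh `1/K` containing a point. -/
noncomputable def gIdx {d : ℕ} (K : ℕ) (q : ℝ × EuclideanSpace ℝ (Fin d)) : ℤ × (Fin d → ℤ) :=
  (⌊(K : ℝ) * q.1⌋, fun j => ⌊(K : ℝ) * q.2 j⌋)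

/-- The lattice vector `l` in Euclidean space. -/
noncomputable def lv {d : ℕ} (l : Fin d → ℤ) : EuclideanSpace ℝ (Fin d) :=
  WithLp.toLp 2 (fun j => (l j : ℝ))

/-- Cell average. -/
noncomputable def cellAvg {d : ℕ} (K : ℕ) (f : ℝ × EuclideanSpace ℝ (Fin d) → ℝ)
    (q : ℝ × EuclideanSpace ℝ (Fin d)) : ℝ :=
  (K : ℝ) ^ (d + 1) * ∫ p in (gIdx K) ⁻¹' {gIdx K q}, f p

lemma measurable_gIdx {d : ℕ} (K : ℕ) : Measurable (gIdx (d := d) K) := by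
  unfold gIdx
  refine Measurable.prodMk (Int.measurable_floor.comp (measurable_fst.const_mul _)) ?_
  refine measurable_pi_lambda _ fun j => Int.measurable_floor.comp (Measurable.const_mul ?_ _)
  fun_prop

lemma gIdx_preimage {d : ℕ} (K : ℕ) (hK : 1 ≤ K) (n : ℤ) (i : Fin d → ℤ) :
    (gIdx K) ⁻¹' {(n, i)} = Set.Ico ((n : ℝ) / K) ((n + 1) / K) ×ˢ
      ((WithLp.ofLp : EuclideanSpace ℝ (Fin d) → (Fin d → ℝ)) ⁻¹'
        (Set.pi Set.univ fun j => Set.Ico ((i j : ℝ) / K) ((i j + 1) / K))) := by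
  have hK0 : (0 : ℝ) < K := by exact_mod_cast hK
  ext ⟨t, x⟩
  simp only [gIdx, Set.mem_preimage, Set.mem_singleton_iff, Prod.mk.injEq, funext_iff,
    Set.mem_prod, Set.mem_univ_pi, Set.mem_Ico, Int.floor_eq_iff, div_le_iff₀ hK0, lt_div_iff₀ hK0,
    mul_comm (K : ℝ)]

lemma volume_gIdx {d : ℕ} (K : ℕ) (hK : 1 ≤ K) (n : ℤ × (Fin d → ℤ)) :
    volume ((gIdx K) ⁻¹' {n}) = ENNReal.ofReal (((K : ℝ) ^ (d + 1))⁻¹) := by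
  have hK0 : (0 : ℝ) < K := by exact_mod_cast hK
  obtain ⟨n, i⟩ := n
  rw [gIdx_preimage K hK, Measure.volume_eq_prod, Measure.prod_prod,
    (PiLp.volume_preserving_ofLp (Fin d)).measure_preimage
      (MeasurableSet.univ_pi fun j => measurableSet_Ico).nullMeasurableSet, volume_pi_pi]
  have h : ∀ m : ℝ, (m + 1) / K - m / K = (K : ℝ)⁻¹ := fun m => by field_simp; ring
  simp only [Real.volume_Ico, h, Finset.prod_const, Finset.card_univ, Fintype.card_fin]
  rw [← ENNReal.ofReal_pow (by positivity), ← ENNReal.ofReal_mul (by positivity)]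
  congr 1
  rw [pow_succ, mul_inv, inv_pow, mul_comm]

lemma measurableSet_gIdx {d : ℕ} (K : ℕ) (n : ℤ × (Fin d → ℤ)) :
    MeasurableSet ((gIdx K) ⁻¹' {n}) :=
  measurable_gIdx K (measurableSet_singleton n)

lemma integrableOn_cell {d : ℕ} (K : ℕ) (hK : 1 ≤ K) (f : ℝ × EuclideanSpace ℝ (Fin d) → ℝ)
    (hfm : Measurable f) (hf0 : ∀ q, 0 ≤ f q) (hfi : Integrable (fun q => f q ^ (d + 1)))
    (s : Set (ℝ × EuclideanSpace ℝ (Fin d))) (hs : volume s ≠ ⊤) :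
    IntegrableOn f s := by
  refine Integrable.mono' (g := fun q => 1 + f q ^ (d + 1)) ?_ hfm.aestronglyMeasurable ?_
  · exact (integrableOn_const hs).add hfi.integrableOn
  · refine Filter.Eventually.of_forall fun q => ?_
    rw [Real.norm_of_nonneg (hf0 q)]
    by_cases h : f q ≤ 1
    · have := pow_nonneg (hf0 q) (d + 1)
      linarith
    · have := le_self_pow₀ (not_le.1 h).le (Nat.succ_ne_zero d)
      simp only [Nat.succ_eq_add_one] at this
      linarith

lemma cellAvg_nonneg {d : ℕ} (K : ℕ) (f : ℝ × EuclideanSpace ℝ (Fin d) → ℝ)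
    (hf0 : ∀ q, 0 ≤ f q) (q) : 0 ≤ cellAvg K f q :=
  mul_nonneg (by positivity) (integral_nonneg hf0)

lemma cellAvg_pow {d : ℕ} (K : ℕ) (hK : 1 ≤ K) (f : ℝ × EuclideanSpace ℝ (Fin d) → ℝ)
    (hfm : Measurable f) (hf0 : ∀ q, 0 ≤ f q) (hfi : Integrable (fun q => f q ^ (d + 1))) (q) :
    cellAvg K f q ^ (d + 1) ≤ (K : ℝ) ^ (d + 1) * ∫ p in (gIdx K) ⁻¹' {gIdx K q}, f p ^ (d + 1) := by
  have hK0 : (0 : ℝ) < K := by exact_mod_cast hK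
  have hv := volume_gIdx K hK (gIdx K q)
  have hr : (volume.real ((gIdx K) ⁻¹' {gIdx K q}))⁻¹ = (K : ℝ) ^ (d + 1) := by
    rw [Measure.real, hv, ENNReal.toReal_ofReal (by positivity), inv_inv]
  have hfin : volume ((gIdx K) ⁻¹' {gIdx K q}) ≠ ⊤ := by rw [hv]; exact ENNReal.ofReal_ne_top
  have := (convexOn_pow (𝕜 := ℝ) (d + 1)).map_set_average_le (μ := volume)
    (t := (gIdx K) ⁻¹' {gIdx K q}) (f := f)
    (continuous_pow _).continuousOn isClosed_Ici
    (by rw [hv]; simp; positivity) hfin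
    (Filter.Eventually.of_forall fun q => hf0 q)
    (integrableOn_cell K hK f hfm hf0 hfi _ hfin) hfi.integrableOn
  rw [setAverage_eq, setAverage_eq, hr] at this
  exact this

lemma gIdx_add {d : ℕ} (K : ℕ) (hK : 1 ≤ K) (t : ℝ) (x : EuclideanSpace ℝ (Fin d))
    (l : Fin d → ℤ) : (gIdx K (t, x + (K : ℝ)⁻¹ • lv l)).2 = (gIdx K (t, x)).2 + l := by
  have hK0 : (0 : ℝ) < K := by exact_mod_cast hK
  funext j
  simp only [gIdx, lv, PiLp.add_apply, PiLp.smul_apply, smul_eq_mul, Pi.add_apply]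
  rw [mul_add, mul_inv_cancel_left₀ hK0.ne', Int.floor_add_intCast]

lemma lv_neg {d : ℕ} (l : Fin d → ℤ) : lv (-l) = - lv l := by
  ext j; simp [lv]

lemma gIdx_sub {d : ℕ} (K : ℕ) (hK : 1 ≤ K) (t : ℝ) (x : EuclideanSpace ℝ (Fin d))
    (l : Fin d → ℤ) : (gIdx K (t, x - (K : ℝ)⁻¹ • lv l)).2 = (gIdx K (t, x)).2 - l := by
  have := gIdx_add K hK t x (-l)
  rw [lv_neg, smul_neg, ← sub_eq_add_neg, ← sub_eq_add_neg] at this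
  exact this

/-- Second difference in the direction `v`. -/
def sD2 {d : ℕ} (w : ℝ × EuclideanSpace ℝ (Fin d) → ℝ) (t : ℝ) (x v : EuclideanSpace ℝ (Fin d)) :
    ℝ := w (t, x + v) + w (t, x - v) - 2 * w (t, x)

lemma exists_basis_row {d : ℕ} (l : Fin d → ℤ) (hl : l ≠ 0) (K : ℤ) (hK : 1 ≤ K)
    (hlK : ∀ j, |l j| ≤ K) : ∃ B : Fin d → Fin d → ℤ, (Matrix.of B).det ≠ 0 ∧
      (∀ i j, |B i j| ≤ K) ∧ ∃ i, B i = l := by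
  obtain ⟨k, hk⟩ := Function.ne_iff.1 hl
  refine ⟨Matrix.updateRow 1 k l, ?_, ?_, k, by simp⟩
  · have h1 : (Matrix.of (Matrix.updateRow (1 : Matrix (Fin d) (Fin d) ℤ) k l)).det
        = Matrix.det (Matrix.updateRow (1 : Matrix (Fin d) (Fin d) ℤ) k l) := rfl
    rw [h1]
    have h2 : l = ∑ i, l i • (1 : Matrix (Fin d) (Fin d) ℤ) i := by
      funext j
      simp [Matrix.one_apply]
    rw [h2, Matrix.det_updateRow_sum, Matrix.det_one]
    simpa using hk
  · intro i j
    by_cases h : i = k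
    · subst h; simpa using hlK j
    · rw [Matrix.updateRow_ne h, Matrix.one_apply]
      split_ifs <;> simp <;> omega

lemma discrete_sol {d : ℕ} (hd : 1 ≤ d) (f : ℝ × EuclideanSpace ℝ (Fin d) → ℝ)
    (hfm : Measurable f) (hf0 : ∀ q, 0 ≤ f q) (hfi : Integrable (fun q => f q ^ (d + 1)))
    (M : ℝ) (hM0 : 0 ≤ M) (hM : 2 * (12 * d : ℝ) ^ d * ∫ q, f q ^ (d + 1) ≤ M ^ (d + 1))
    (K : ℕ) (hK : 1 ≤ K) :
    ∃ w : ℝ × EuclideanSpace ℝ (Fin d) → ℝ, Measurable w ∧ (∀ q, w q ≤ 0) ∧ (∀ q, -M ≤ w q) ∧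
      (∀ x, Monotone fun t => w (t, x)) ∧
      (∀ t x, ‖x‖ < 5 → ∀ l : Fin d → ℤ, (∀ j, |l j| ≤ K) → 0 ≤ sD2 w t x ((K : ℝ)⁻¹ • lv l)) ∧
      (∀ (t : ℝ) x, 0 ≤ t → t < K → ‖x‖ < 5 → ∀ B : Fin d → Fin d → ℤ, (Matrix.of B).det ≠ 0 →
        (∀ i j, |B i j| ≤ K) → ∀ lam : Fin d → ℝ, (∀ i, 0 < lam i) → ∀ θ : ℝ, 0 ≤ θ →
        θ ^ (d + 1) ≤ ∏ i, lam i →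
        θ * cellAvg K f (t, x) ≤ K * (w (t + (K : ℝ)⁻¹, x) - w (t, x)) +
          ∑ i, lam i * (K ^ 2 * sD2 w t x ((K : ℝ)⁻¹ • lv (B i)))) := by
  classical
  have hK0 : (0 : ℝ) < K := by exact_mod_cast hK
  let N : ℕ := K * K
  let I : Finset (Fin d → ℤ) := Fintype.piFinset fun _ => Finset.Icc (-(5 * K : ℤ)) (5 * K)
  let J : Finset (Fin d → ℤ) := Fintype.piFinset fun _ => Finset.Icc (-(6 * K : ℤ)) (6 * K)
  let Bs : Finset (Fin d → Fin d → ℤ) :=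
    (Fintype.piFinset fun _ => Fintype.piFinset fun _ => Finset.Icc (-(K : ℤ)) K).filter
      fun B => (Matrix.of B).det ≠ 0
  let g : ℕ → (Fin d → ℤ) → ℝ := fun n i =>
    ((K : ℝ) ^ d)⁻¹ * ∫ p in (gIdx K) ⁻¹' {((n : ℤ), i)}, f p ^ (d + 1)
  have hg : ∀ n x, 0 ≤ g n x := fun n x =>
    mul_nonneg (by positivity) (integral_nonneg fun p => pow_nonneg (hf0 p) _)
  have hI : ∀ x, x ∈ I ↔ ∀ j, |x j| ≤ 5 * K := by
    intro x; simp only [I, Fintype.mem_piFinset, Finset.mem_Icc, abs_le]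
  have hJm : ∀ x, x ∈ J ↔ ∀ j, |x j| ≤ 6 * K := by
    intro x; simp only [J, Fintype.mem_piFinset, Finset.mem_Icc, abs_le]
  have hBs : ∀ B, B ∈ Bs ↔ (Matrix.of B).det ≠ 0 ∧ ∀ i j, |B i j| ≤ K := by
    intro x
    simp only [Bs, Finset.mem_filter, Fintype.mem_piFinset, Finset.mem_Icc, abs_le]
    exact and_comm
  have hIJ : ∀ x ∈ I, x ∈ J := by
    intro x hx
    rw [hI] at hx; rw [hJm]
    intro j
    have := hx j
    omega
  have hB0 : ∀ B ∈ Bs, ∀ i, B i ≠ 0 := by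
    intro B hB i h
    exact ((hBs B).1 hB).1 (Matrix.det_eq_zero_of_row_eq_zero i fun j => congrFun h j)
  have hJ : ∀ x ∈ I, ∀ B ∈ Bs, ∀ i, x + B i ∈ J ∧ x - B i ∈ J := by
    intro x hx B hB i
    rw [hI] at hx
    have h2 := ((hBs B).1 hB).2 i
    simp only [hJm, Pi.add_apply, Pi.sub_apply]
    constructor <;> intro j <;> have h3 := hx j <;> have h4 := h2 j <;>
      rw [abs_le] at h3 h4 ⊢ <;> constructor <;> linarith [h3.1, h3.2, h4.1, h4.2]
  obtain ⟨z, hz, htight⟩ := lat_perron N I J Bs g hg hIJ hB0 hJ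
  have hest := lat_estimate hd N I J Bs g hg hIJ (fun B hB => ((hBs B).1 hB).1) hJ (6 * K)
    (by positivity) (fun y hy i => by exact_mod_cast (hJm y).1 hy i) z hz htight
  have hsum : ∑ n ∈ Finset.range N, ∑ x ∈ I, g n x ≤ ((K : ℝ) ^ d)⁻¹ * ∫ q, f q ^ (d + 1) := by
    simp only [g, ← Finset.mul_sum]
    refine mul_le_mul_of_nonneg_left ?_ (by positivity)
    rw [← Finset.sum_product' (Finset.range N) I
      (fun n x => ∫ p in (gIdx K) ⁻¹' {((n : ℤ), x)}, f p ^ (d + 1))]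
    rw [← integral_biUnion_finset (f := fun p => f p ^ (d + 1)) (Finset.range N ×ˢ I)
      (s := fun nx => (gIdx K) ⁻¹' {((nx.1 : ℤ), nx.2)})
      (fun i _ => measurableSet_gIdx K _) ?_ (fun i _ => hfi.integrableOn)]
    · exact setIntegral_le_integral hfi (Filter.Eventually.of_forall fun p => pow_nonneg (hf0 p) _)
    · rintro ⟨n, x⟩ _ ⟨m, y⟩ _ hne
      refine Disjoint.preimage _ (Set.disjoint_singleton.2 fun h => hne ?_)
      simpa using h
  have hbound : ∀ n x, -M ≤ z n x := by
    intro n x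
    have h1 : (-z n x) ^ (d + 1) ≤ M ^ (d + 1) := by
      refine (hest n x).trans (le_trans ?_ hM)
      refine (mul_le_mul_of_nonneg_left hsum (by positivity)).trans (le_of_eq ?_)
      rw [show (2 * d * (6 * K) : ℝ) = 12 * d * K by ring, mul_pow]
      field_simp
    have h2 := (pow_le_pow_iff_left₀ (neg_nonneg.2 (hz.nonpos n x)) hM0 (Nat.succ_ne_zero d)).1 h1
    linarith
  let w : ℝ × EuclideanSpace ℝ (Fin d) → ℝ := fun q => z (gIdx K q).1.toNat (gIdx K q).2
  have hxI : ∀ t (x : EuclideanSpace ℝ (Fin d)), ‖x‖ < 5 → (gIdx K (t, x)).2 ∈ I := by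
    intro t x hx
    rw [hI]
    intro j
    have h1 : |x j| < 5 := lt_of_le_of_lt (by simpa using PiLp.norm_apply_le x j) hx
    rw [abs_lt] at h1
    simp only [gIdx]
    rw [abs_le]
    constructor
    · rw [Int.le_floor]; push_cast; nlinarith
    · have := Int.floor_le ((K : ℝ) * x j)
      have h3 : ((⌊(K : ℝ) * x j⌋ : ℤ) : ℝ) ≤ ((5 * K : ℤ) : ℝ) := by push_cast; nlinarith
      exact_mod_cast h3
  have hD2 : ∀ t (x : EuclideanSpace ℝ (Fin d)) l, sD2 w t x ((K : ℝ)⁻¹ • lv l)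
      = latD2 (z (gIdx K (t, x)).1.toNat) (gIdx K (t, x)).2 l := by
    intro t x l
    simp only [sD2, latD2, w, gIdx_add K hK, gIdx_sub K hK]
    rfl
  have hconv : ∀ t x, ‖x‖ < 5 → ∀ l : Fin d → ℤ, (∀ j, |l j| ≤ K) →
      0 ≤ sD2 w t x ((K : ℝ)⁻¹ • lv l) := by
    intro t x hx l hl
    rw [hD2]
    by_cases hl0 : l = 0
    · subst hl0; simp [latD2]; linarith
    by_cases hn : (gIdx K (t, x)).1.toNat < N
    · obtain ⟨B, hB1, hB2, i, hi⟩ := exists_basis_row l hl0 K (by exact_mod_cast hK) hl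
      rw [← hi]
      exact hz.conv _ hn _ (hxI t x hx) B ((hBs B).2 ⟨hB1, hB2⟩) i
    · have : ∀ y, z (gIdx K (t, x)).1.toNat y = 0 := fun y => hz.zero _ _ fun h => hn h.1
      simp [latD2, this]
  have hmono : ∀ x, Monotone fun n => z n x := fun x => monotone_nat_of_le_succ fun n => hz.mono n x
  refine ⟨w, ?_, fun q => hz.nonpos _ _, fun q => hbound _ _, ?_, hconv, ?_⟩
  · have : w = (fun n : ℤ × (Fin d → ℤ) => z n.1.toNat n.2) ∘ gIdx K := rfl
    rw [this]
    exact Measurable.comp (measurable_of_countable _) (measurable_gIdx K)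
  · intro x t s hts
    refine hmono _ (Int.toNat_le_toNat (Int.floor_mono ?_))
    simpa using mul_le_mul_of_nonneg_left hts hK0.le
  · intro t x ht htK hx B hB1 hB2 lam hlam θ hθ hθl
    have hfl : 0 ≤ (gIdx K (t, x)).1 := Int.floor_nonneg.2 (mul_nonneg hK0.le ht)
    set n := (gIdx K (t, x)).1.toNat with hn
    set i := (gIdx K (t, x)).2 with hi
    have hnn : (n : ℤ) = (gIdx K (t, x)).1 := Int.toNat_of_nonneg hfl
    have hnN : n < N := by
      have h1 : (gIdx K (t, x)).1 < (N : ℤ) := by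
        refine Int.floor_lt.2 ?_
        simp only [N]
        push_cast
        exact mul_lt_mul_of_pos_left htK hK0
      omega
    have hw1 : w (t + (K : ℝ)⁻¹, x) = z (n + 1) i := by
      simp only [w]
      have h1 : (gIdx K (t + (K : ℝ)⁻¹, x)).1 = (gIdx K (t, x)).1 + 1 := by
        simp only [gIdx]
        rw [mul_add, mul_inv_cancel₀ hK0.ne', Int.floor_add_one]
      rw [h1, ← hnn]
      have : ((n : ℤ) + 1).toNat = n + 1 := by omega
      rw [this]
      rfl
    have hw0 : w (t, x) = z n i := rfl
    have hBm : B ∈ Bs := (hBs B).2 ⟨hB1, hB2⟩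
    have hprod := hz.prod n hnN i (hxI t x hx) B hBm
    rw [hw1, hw0]
    set A : ℝ := K * (z (n + 1) i - z n i) with hA
    set D : Fin d → ℝ := fun k => lam k * (K ^ 2 * sD2 w t x ((K : ℝ)⁻¹ • lv (B k))) with hD
    have hA0 : 0 ≤ A := mul_nonneg hK0.le (sub_nonneg.2 (hz.mono n i))
    have hD0 : ∀ k, 0 ≤ D k := fun k =>
      mul_nonneg (hlam k).le (mul_nonneg (by positivity) (hconv t x hx _ (hB2 k)))
    have hS0 : 0 ≤ ∑ k, D k := Finset.sum_nonneg fun k _ => hD0 k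
    rw [← pow_le_pow_iff_left₀ (mul_nonneg hθ (cellAvg_nonneg K f hf0 _)) (add_nonneg hA0 hS0)
      (Nat.succ_ne_zero d), mul_pow]
    have hup : A * ∏ k, D k ≤ (A + ∑ k, D k) ^ (d + 1) := by
      rw [pow_succ']
      refine mul_le_mul (by linarith) ?_ (Finset.prod_nonneg fun k _ => hD0 k) (by linarith)
      calc ∏ k, D k ≤ ∏ k : Fin d, (A + ∑ k, D k) := by
            refine Finset.prod_le_prod (fun k _ => hD0 k) fun k _ => ?_
            have := Finset.single_le_sum (f := D) (fun k _ => hD0 k) (Finset.mem_univ k)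
            linarith
        _ = _ := by simp
    refine le_trans ?_ hup
    have hDp : A * ∏ k, D k = (K : ℝ) ^ (d + 1) * (K : ℝ) ^ d * (∏ k, lam k) *
        ((z (n + 1) i - z n i) * ∏ k, latD2 (z n) i (B k)) := by
      simp only [hD, hA, hD2, Finset.prod_mul_distrib, Finset.prod_const, Finset.card_univ,
        Fintype.card_fin]
      ring
    rw [hDp]
    have hlp : 0 ≤ ∏ k, lam k := Finset.prod_nonneg fun k _ => (hlam k).le
    calc θ ^ (d + 1) * cellAvg K f (t, x) ^ (d + 1)
        ≤ (∏ k, lam k) * ((K : ℝ) ^ (d + 1) *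
          ∫ p in (gIdx K) ⁻¹' {gIdx K (t, x)}, f p ^ (d + 1)) := by
          refine mul_le_mul hθl (cellAvg_pow K hK f hfm hf0 hfi _) ?_ hlp
          exact pow_nonneg (cellAvg_nonneg K f hf0 _) _
      _ = (K : ℝ) ^ (d + 1) * (K : ℝ) ^ d * (∏ k, lam k) * g n i := by
          have : gIdx K (t, x) = ((n : ℤ), i) := by rw [hnn]
          simp only [g]
          rw [this]
          field_simp
      _ ≤ _ := by
          refine mul_le_mul_of_nonneg_left hprod ?_
          positivity


lemma hilbert_ultralim {H ι : Type*} [NormedAddCommGroup H] [InnerProductSpace ℝ H] [CompleteSpace H]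
    (U : Ultrafilter ι) (W : ι → H) (R : ℝ) (h : ∀ k, ‖W k‖ ≤ R) :
    ∃ Z : H, ∀ v, Filter.Tendsto (fun k => inner ℝ (W k) v) U (nhds (inner ℝ Z v)) := by
  have hc := WeakDual.isCompact_closedBall (𝕜 := ℝ) (E := H) 0 R
  let D : ι → WeakDual ℝ H := fun k => StrongDual.toWeakDual (InnerProductSpace.toDual ℝ H (W k))
  obtain ⟨ψ, -, hψ⟩ := hc.ultrafilter_le_nhds (U.map D) (by
    rw [Filter.le_principal_iff]
    refine Filter.mem_map.2 (Filter.Eventually.of_forall fun k => ?_)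
    simp only [Set.mem_preimage, D, mem_closedBall_zero_iff]
    exact (by simpa using h k))
  refine ⟨(InnerProductSpace.toDual ℝ H).symm (WeakDual.toStrongDual ψ), fun v => ?_⟩
  have h1 : Filter.Tendsto D U (nhds ψ) := hψ
  have h2 := ((WeakDual.eval_continuous v).tendsto ψ).comp h1
  have h3 : Filter.Tendsto (fun k => inner ℝ (W k) v) U (nhds (ψ v)) := h2
  simpa using h3

lemma weak_limit {d : ℕ} {ι : Type*} (U : Ultrafilter ι) (w : ι → ℝ × EuclideanSpace ℝ (Fin d) → ℝ)
    (M : ℝ) (hwm : ∀ k, Measurable (w k)) (hwb : ∀ k q, |w k q| ≤ M) :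
    ∃ ζ : ℝ × EuclideanSpace ℝ (Fin d) → ℝ, LocallyIntegrable ζ ∧
      ∀ φ : ℝ × EuclideanSpace ℝ (Fin d) → ℝ, Continuous φ → HasCompactSupport φ →
        Filter.Tendsto (fun k => ∫ q, w k q * φ q) U (nhds (∫ q, ζ q * φ q)) := by
  have : (volume : Measure (ℝ × EuclideanSpace ℝ (Fin d))).IsAddHaarMeasure := by
    rw [Measure.volume_eq_prod]; infer_instance
  set r : ℝ := (Module.finrank ℝ (ℝ × EuclideanSpace ℝ (Fin d)) : ℝ) + 1 with hr
  let ρ : ℝ × EuclideanSpace ℝ (Fin d) → ℝ := fun q => (1 + ‖q‖) ^ (-r)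
  have hpos : ∀ q : ℝ × EuclideanSpace ℝ (Fin d), 0 < 1 + ‖q‖ := fun q => by positivity
  have hρ0 : ∀ q, 0 < ρ q := fun q => Real.rpow_pos_of_pos (hpos q) _
  have hρ1 : ∀ q, ρ q ≤ 1 := fun q => by
    refine Real.rpow_le_one_of_one_le_of_nonpos (by linarith [norm_nonneg q]) ?_
    have : 0 ≤ (Module.finrank ℝ (ℝ × EuclideanSpace ℝ (Fin d)) : ℝ) := by positivity
    linarith
  have hρc : Continuous ρ :=
    Continuous.rpow_const (by fun_prop) fun q => Or.inl (hpos q).ne'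
  have hρi : Integrable ρ := integrable_one_add_norm (by linarith)
  have hρ2 : MemLp ρ 2 := by
    rw [memLp_two_iff_integrable_sq hρc.aestronglyMeasurable]
    refine hρi.mono' (hρc.pow 2).aestronglyMeasurable (Filter.Eventually.of_forall fun q => ?_)
    rw [Real.norm_of_nonneg (by positivity)]
    nlinarith [hρ0 q, hρ1 q]
  have hWm : ∀ k, MemLp (fun q => w k q * ρ q) 2 := fun k => by
    refine MemLp.of_le_mul (c := M) hρ2 ((hwm k).mul hρc.measurable).aestronglyMeasurable
      (Filter.Eventually.of_forall fun q => ?_)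
    rw [norm_mul]
    exact mul_le_mul_of_nonneg_right (hwb k q) (norm_nonneg _)
  obtain ⟨Z, hZ⟩ := hilbert_ultralim U (fun k => (hWm k).toLp _) (M * ‖hρ2.toLp ρ‖) (by
    intro k
    refine Lp.norm_le_mul_norm_of_ae_le_mul ?_
    filter_upwards [(hWm k).coeFn_toLp, hρ2.coeFn_toLp] with q h1 h2
    rw [h1, h2, norm_mul]
    exact mul_le_mul_of_nonneg_right (hwb k q) (norm_nonneg _))
  refine ⟨fun q => Z q * (ρ q)⁻¹, ?_, fun φ hφ hφc => ?_⟩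
  · have hZl : LocallyIntegrable Z := (Lp.memLp Z).locallyIntegrable (by norm_num)
    rw [← locallyIntegrableOn_univ] at hZl ⊢
    rw [locallyIntegrableOn_iff isClosed_univ.isLocallyClosed] at hZl ⊢
    intro k hk hkc
    exact (hZl k hk hkc).mul_continuousOn (hρc.inv₀ fun q => (hρ0 q).ne').continuousOn hkc
  · have hφρc : Continuous fun q => (ρ q)⁻¹ * φ q := (hρc.inv₀ fun q => (hρ0 q).ne').mul hφ
    have hφρ : MemLp (fun q => (ρ q)⁻¹ * φ q) 2 :=
      hφρc.memLp_of_hasCompactSupport hφc.mul_left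
    have h := hZ (hφρ.toLp _)
    simp only [L2.inner_def] at h
    convert h using 1
    · funext k
      refine integral_congr_ae ?_
      filter_upwards [(hWm k).coeFn_toLp, hφρ.coeFn_toLp] with q h1 h2
      rw [h1, h2]
      have := (hρ0 q).ne'
      simp
      field_simp
    · congr 1
      refine integral_congr_ae ?_
      filter_upwards [hφρ.coeFn_toLp] with q h2
      rw [h2]
      simp
      ring


/-- Space-time. -/
abbrev SpT (d : ℕ) : Type := ℝ × EuclideanSpace ℝ (Fin d)

instance stHaar {d : ℕ} : (volume : Measure (SpT d)).IsAddHaarMeasure := by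
  rw [Measure.volume_eq_prod]; infer_instance

/-- Directional derivative. -/
noncomputable def dv {X : Type*} [NormedAddCommGroup X] [NormedSpace ℝ X]
    (g : X → ℝ) (e : X) : X → ℝ := fun r => fderiv ℝ g r e

lemma dv_contDiff {X : Type*} [NormedAddCommGroup X] [NormedSpace ℝ X]
    {g : X → ℝ} (hg : ContDiff ℝ (⊤ : ℕ∞) g) (e : X) : ContDiff ℝ (⊤ : ℕ∞) (dv g e) :=
  (hg.fderiv_right (m := ((⊤ : ℕ∞) : WithTop ℕ∞)) (by exact_mod_cast le_rfl)).clm_apply contDiff_const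

lemma dv_compact {X : Type*} [NormedAddCommGroup X] [NormedSpace ℝ X]
    {g : X → ℝ} (hg : HasCompactSupport g) (e : X) : HasCompactSupport (dv g e) :=
  hg.fderiv_apply ℝ e

lemma dv_line {X : Type*} [NormedAddCommGroup X] [NormedSpace ℝ X]
    {g : X → ℝ} (hg : ContDiff ℝ (⊤ : ℕ∞) g) (s v : X) (τ : ℝ) :
    HasDerivAt (fun τ : ℝ => g (s + τ • v)) (dv g v (s + τ • v)) τ := by
  have h1 : HasDerivAt (fun τ : ℝ => s + τ • v) v τ := by
    simpa using ((hasDerivAt_id τ).smul_const v).const_add s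
  have h2 := (hg.differentiable (by simp)) (s + τ • v)
  exact h2.hasFDerivAt.comp_hasDerivAt τ h1

lemma mvt1 {X : Type*} [NormedAddCommGroup X] [NormedSpace ℝ X]
    {g : X → ℝ} (hg : ContDiff ℝ (⊤ : ℕ∞) g) (s v : X) (h : ℝ) (hh : 0 < h) :
    ∃ σ : ℝ, |σ| ≤ h ∧ g (s + h • v) - g s = h * dv g v (s + σ • v) := by
  obtain ⟨c, hc, h1⟩ := exists_hasDerivAt_eq_slope (fun τ : ℝ => g (s + τ • v))
    (fun τ => dv g v (s + τ • v)) hh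
    (fun τ _ => (dv_line hg s v τ).continuousAt.continuousWithinAt)
    (fun τ _ => dv_line hg s v τ)
  refine ⟨c, by rw [abs_of_pos hc.1]; exact hc.2.le, ?_⟩
  rw [h1]
  simp
  field_simp

lemma mvt2 {X : Type*} [NormedAddCommGroup X] [NormedSpace ℝ X]
    {g : X → ℝ} (hg : ContDiff ℝ (⊤ : ℕ∞) g) (s v : X) (h : ℝ) (hh : 0 < h) :
    ∃ σ : ℝ, |σ| ≤ h ∧ g (s + h • v) + g (s - h • v) - 2 * g s
      = h ^ 2 * dv (dv g v) v (s + σ • v) := by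
  have hF : ∀ τ : ℝ, HasDerivAt (fun τ : ℝ => g (s + τ • v) + g (s + (-τ) • v))
      (dv g v (s + τ • v) - dv g v (s + (-τ) • v)) τ := by
    intro τ
    have h2 := (dv_line hg s v (-τ)).comp τ (hasDerivAt_neg τ)
    have h3 := (dv_line hg s v τ).add h2
    have h4 : dv g v (s + τ • v) - dv g v (s + (-τ) • v) =
        dv g v (s + τ • v) + dv g v (s + (-τ) • v) * -1 := by ring
    rw [h4]
    exact h3
  have hG : ∀ τ : ℝ, HasDerivAt (fun τ : ℝ => τ ^ 2) (2 * τ) τ := by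
    intro τ; simpa using hasDerivAt_pow 2 τ
  obtain ⟨c, hc, h1⟩ := exists_ratio_hasDerivAt_eq_ratio_slope
    (fun τ : ℝ => g (s + τ • v) + g (s + (-τ) • v)) _ hh
    (fun τ _ => (hF τ).continuousAt.continuousWithinAt) (fun τ _ => hF τ)
    (fun τ : ℝ => τ ^ 2) _ (fun τ _ => (hG τ).continuousAt.continuousWithinAt) (fun τ _ => hG τ)
  have hcc : -c < c := by linarith [hc.1]
  obtain ⟨b, hb, h2⟩ := exists_hasDerivAt_eq_slope (fun τ : ℝ => dv g v (s + τ • v))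
    (fun τ => dv (dv g v) v (s + τ • v)) hcc
    (fun τ _ => (dv_line (dv_contDiff hg v) s v τ).continuousAt.continuousWithinAt)
    (fun τ _ => dv_line (dv_contDiff hg v) s v τ)
  refine ⟨b, abs_le.2 ⟨by linarith [hb.1, hc.2], by linarith [hb.2, hc.2]⟩, ?_⟩
  have hc0 : c ≠ 0 := hc.1.ne'
  simp only [h2]
  simp only [zero_smul, add_zero, neg_zero, sub_neg_eq_add] at h1 ⊢
  have h3 : g (s - h • v) = g (s + (-h) • v) := by rw [neg_smul, sub_eq_add_neg]
  rw [h3]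
  field_simp
  linarith

/-- A family converging weakly, along an ultrafilter, against test functions. -/
structure WeakLim {d : ℕ} (U : Filter ℕ) (w : ℕ → SpT d → ℝ) (M : ℝ) (ζ : SpT d → ℝ) : Prop where
  meas : ∀ k, Measurable (w k)
  bdd : ∀ k q, |w k q| ≤ M
  loc : LocallyIntegrable ζ
  lim : ∀ φ : SpT d → ℝ, Continuous φ → HasCompactSupport φ →
        Filter.Tendsto (fun k => ∫ q, w k q * φ q) U (nhds (∫ q, ζ q * φ q))

lemma WeakLim.integrable {d : ℕ} {U : Filter ℕ} {w : ℕ → SpT d → ℝ} {M : ℝ} {ζ : SpT d → ℝ}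
    (hw : WeakLim U w M ζ) (k : ℕ) {φ : SpT d → ℝ} (hφ : Integrable φ) :
    Integrable fun q => w k q * φ q :=
  hφ.bdd_mul (c := M) (hw.meas k).aestronglyMeasurable (Filter.Eventually.of_forall fun q => hw.bdd k q)

lemma lim_int {d : ℕ} {U : Filter ℕ} {w : ℕ → SpT d → ℝ} {M : ℝ} {ζ : SpT d → ℝ}
    (hw : WeakLim U w M ζ) (φ : SpT d → ℝ) (hφ : Continuous φ) (hφc : HasCompactSupport φ)
    (g : ℕ → SpT d → ℝ) (hg : ∀ k, Continuous (g k)) (h : ℕ → ℝ) (hU : Filter.Tendsto h U (nhds 0))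
    (R : ℝ) (hR : ∀ k, h k ≤ R)
    (hgφ : ∀ k s, ∃ p, dist p s ≤ h k ∧ g k s = φ p) :
    Filter.Tendsto (fun k => ∫ q, w k q * g k q) U (nhds (∫ q, ζ q * φ q)) := by
  have hM : 0 ≤ M := (abs_nonneg _).trans (hw.bdd 0 0)
  have hR0 : 0 ≤ R := by
    obtain ⟨p, hp, -⟩ := hgφ 0 0
    exact dist_nonneg.trans (hp.trans (hR 0))
  set C := Metric.cthickening R (tsupport φ) with hC
  have hCc : IsCompact C := hφc.isCompact.cthickening
  have hCf : volume C < ⊤ := hCc.measure_lt_top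
  have hg0 : ∀ k, ∀ s ∉ C, g k s = 0 := by
    intro k s hs
    obtain ⟨p, hp, hgp⟩ := hgφ k s
    rw [hgp]
    by_contra hne
    refine hs (Metric.mem_cthickening_of_dist_le s p R _ (subset_tsupport φ hne) ?_)
    rw [dist_comm]
    exact hp.trans (hR k)
  have hφ0 : ∀ s ∉ C, φ s = 0 := by
    intro s hs
    by_contra hne
    exact hs (Metric.self_subset_cthickening _ (subset_tsupport φ hne))
  have hgc : ∀ k, HasCompactSupport (g k) := fun k => HasCompactSupport.intro hCc (hg0 k)
  have hgi : ∀ k, Integrable (g k) := fun k => (hg k).integrable_of_hasCompactSupport (hgc k)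
  have hφi : Integrable φ := hφ.integrable_of_hasCompactSupport hφc
  have hdiff : Filter.Tendsto (fun k => ∫ q, w k q * (g k q - φ q)) U (nhds 0) := by
    rw [Metric.tendsto_nhds]
    intro ε hε
    have huc := hφc.uniformContinuous_of_continuous hφ
    rw [Metric.uniformContinuous_iff] at huc
    set η := ε / (M * (volume.real C) + 1) with hη
    have hden : 0 < M * (volume.real C) + 1 := by positivity
    have hη0 : 0 < η := by positivity
    obtain ⟨δ, hδ, hδ'⟩ := huc η hη0
    filter_upwards [hU.eventually (gt_mem_nhds hδ)] with k hk
    rw [dist_zero_right]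
    have h1 : ∫ q, w k q * (g k q - φ q) = ∫ q in C, w k q * (g k q - φ q) := by
      refine (setIntegral_eq_integral_of_forall_compl_eq_zero fun q hq => ?_).symm
      rw [hg0 k q hq, hφ0 q hq]; simp
    rw [h1]
    have h2 := norm_setIntegral_le_of_norm_le_const (μ := volume) (s := C)
      (f := fun q => w k q * (g k q - φ q)) (C := M * η) hCf (fun q _ => by
        rw [norm_mul]
        refine mul_le_mul (hw.bdd k q) ?_ (norm_nonneg _) hM
        obtain ⟨p, hp, hgp⟩ := hgφ k q
        rw [hgp, ← dist_eq_norm]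
        exact (hδ' (lt_of_le_of_lt hp hk)).le)
    refine lt_of_le_of_lt h2 ?_
    have : M * η * volume.real C = ε * (M * volume.real C) / (M * volume.real C + 1) := by
      rw [hη]; field_simp
    rw [this, div_lt_iff₀ hden]
    linarith
  have hsum := hdiff.add (hw.lim φ hφ hφc)
  rw [zero_add] at hsum
  refine hsum.congr fun k => ?_
  have hi1 : Integrable fun q => w k q * (g k q - φ q) := hw.integrable k ((hgi k).sub hφi)
  rw [← integral_add hi1 (hw.integrable k hφi)]
  refine integral_congr_ae (Filter.Eventually.of_forall fun q => ?_)
  simp only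
  ring

lemma hseq_tendsto (c : ℝ) : Filter.Tendsto (fun k : ℕ => ((k + 1 : ℕ) : ℝ)⁻¹ * c) Filter.atTop (nhds 0) := by
  have := (tendsto_one_div_add_atTop_nhds_zero_nat (𝕜 := ℝ)).mul_const c
  simpa using this

lemma hseq_le (k : ℕ) (c : ℝ) (hc : 0 ≤ c) : ((k + 1 : ℕ) : ℝ)⁻¹ * c ≤ c := by
  have : ((k + 1 : ℕ) : ℝ)⁻¹ ≤ 1 := inv_le_one_of_one_le₀ (by push_cast; linarith [(k.cast_nonneg : (0 : ℝ) ≤ k)])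
  nlinarith

lemma translate_int {d : ℕ} (w ψ : SpT d → ℝ) (v : SpT d) :
    ∫ s, w (s + v) * ψ s = ∫ s, w s * ψ (s - v) := by
  rw [← integral_add_right_eq_self (fun s => w s * ψ (s - v)) v]
  simp

lemma int_comb {α : Type*} [MeasurableSpace α] {μ : Measure α} {A B C : α → ℝ}
    (hA : Integrable A μ) (hB : Integrable B μ) (hC : Integrable C μ) :
    ∫ q, (A q + B q - 2 * C q) ∂μ = ∫ q, A q ∂μ + ∫ q, B q ∂μ - 2 * ∫ q, C q ∂μ := by
  have h1 : Integrable (fun q => A q + B q) μ := hA.add hB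
  rw [integral_sub h1 (hC.const_mul 2), integral_add hA hB, integral_const_mul]

/-- limit of first differences -/
lemma lim_diff1 {d : ℕ} {U : Filter ℕ} (hU : U ≤ Filter.atTop) {w : ℕ → SpT d → ℝ} {M : ℝ} {ζ : SpT d → ℝ}
    (hw : WeakLim U w M ζ) (ψ : SpT d → ℝ) (hψ : ContDiff ℝ (⊤ : ℕ∞) ψ) (hψc : HasCompactSupport ψ)
    (v : SpT d) :
    Filter.Tendsto (fun k : ℕ => ∫ q, ((k + 1 : ℕ) : ℝ) *
      (w k (q + ((k + 1 : ℕ) : ℝ)⁻¹ • v) - w k q) * ψ q) U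
      (nhds (∫ q, ζ q * dv ψ (-v) q)) := by
  have h := lim_int hw (dv ψ (-v)) (dv_contDiff hψ _).continuous (dv_compact hψc _)
    (fun k s => ((k + 1 : ℕ) : ℝ) * (ψ (s + ((k + 1 : ℕ) : ℝ)⁻¹ • (-v)) - ψ s))
    (fun k => by have := hψ.continuous; fun_prop)
    (fun k => ((k + 1 : ℕ) : ℝ)⁻¹ * ‖v‖) ((hseq_tendsto _).mono_left hU) ‖v‖
    (fun k => hseq_le k _ (norm_nonneg _)) (fun k s => by
      have hk : (0 : ℝ) < ((k + 1 : ℕ) : ℝ)⁻¹ := by positivity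
      obtain ⟨σ, hσ, he⟩ := mvt1 hψ s (-v) _ hk
      refine ⟨s + σ • (-v), ?_, ?_⟩
      · rw [dist_eq_norm, add_sub_cancel_left, norm_smul, norm_neg]
        exact mul_le_mul_of_nonneg_right hσ (norm_nonneg _)
      · rw [he]
        field_simp)
  refine h.congr fun k => ?_
  have hψi : Integrable ψ := hψ.continuous.integrable_of_hasCompactSupport hψc
  set hk := ((k + 1 : ℕ) : ℝ)⁻¹
  have h1 : Integrable fun q => w k (q + hk • v) * ψ q :=
    hψi.bdd_mul (c := M) ((hw.meas k).comp (measurable_add_const _)).aestronglyMeasurable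
      (Filter.Eventually.of_forall fun q => hw.bdd k _)
  have h2 : Integrable fun q => w k q * ψ q := hw.integrable k hψi
  have h3 : Integrable fun q => w k q * ψ (q - hk • v) :=
    hw.integrable k (hψi.comp_sub_right _)
  have e1 : ∀ q, w k q * (((k + 1 : ℕ) : ℝ) * (ψ (q + hk • (-v)) - ψ q))
      = ((k + 1 : ℕ) : ℝ) * (w k q * ψ (q - hk • v) - w k q * ψ q) := by
    intro q; rw [smul_neg, ← sub_eq_add_neg]; ring
  have e2 : ∀ q, ((k + 1 : ℕ) : ℝ) * (w k (q + hk • v) - w k q) * ψ q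
      = ((k + 1 : ℕ) : ℝ) * (w k (q + hk • v) * ψ q - w k q * ψ q) := by
    intro q; ring
  simp only [e1, e2]
  rw [integral_const_mul, integral_const_mul, integral_sub h3 h2, integral_sub h1 h2, translate_int]

/-- limit of second differences -/
lemma lim_diff2 {d : ℕ} {U : Filter ℕ} (hU : U ≤ Filter.atTop) {w : ℕ → SpT d → ℝ} {M : ℝ} {ζ : SpT d → ℝ}
    (hw : WeakLim U w M ζ) (ψ : SpT d → ℝ) (hψ : ContDiff ℝ (⊤ : ℕ∞) ψ) (hψc : HasCompactSupport ψ)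
    (v : SpT d) :
    Filter.Tendsto (fun k : ℕ => ∫ q, ((k + 1 : ℕ) : ℝ) ^ 2 *
      (w k (q + ((k + 1 : ℕ) : ℝ)⁻¹ • v) + w k (q - ((k + 1 : ℕ) : ℝ)⁻¹ • v) - 2 * w k q) * ψ q) U
      (nhds (∫ q, ζ q * dv (dv ψ v) v q)) := by
  have h := lim_int hw (dv (dv ψ v) v) (dv_contDiff (dv_contDiff hψ _) _).continuous
    (dv_compact (dv_compact hψc _) _)
    (fun k s => ((k + 1 : ℕ) : ℝ) ^ 2 * (ψ (s + ((k + 1 : ℕ) : ℝ)⁻¹ • v) +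
      ψ (s - ((k + 1 : ℕ) : ℝ)⁻¹ • v) - 2 * ψ s))
    (fun k => by have := hψ.continuous; fun_prop)
    (fun k => ((k + 1 : ℕ) : ℝ)⁻¹ * ‖v‖) ((hseq_tendsto _).mono_left hU) ‖v‖
    (fun k => hseq_le k _ (norm_nonneg _)) (fun k s => by
      have hk : (0 : ℝ) < ((k + 1 : ℕ) : ℝ)⁻¹ := by positivity
      obtain ⟨σ, hσ, he⟩ := mvt2 hψ s v _ hk
      refine ⟨s + σ • v, ?_, ?_⟩
      · rw [dist_eq_norm, add_sub_cancel_left, norm_smul]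
        exact mul_le_mul_of_nonneg_right hσ (norm_nonneg _)
      · rw [he]
        field_simp)
  refine h.congr fun k => ?_
  have hψi : Integrable ψ := hψ.continuous.integrable_of_hasCompactSupport hψc
  set hk := ((k + 1 : ℕ) : ℝ)⁻¹
  have h1 : ∀ u, Integrable fun q => w k (q + u) * ψ q := fun u =>
    hψi.bdd_mul (c := M) ((hw.meas k).comp (measurable_add_const _)).aestronglyMeasurable
      (Filter.Eventually.of_forall fun q => hw.bdd k _)
  have h2 : Integrable fun q => w k q * ψ q := hw.integrable k hψi
  have h3 : ∀ u, Integrable fun q => w k q * ψ (q - u) := fun u =>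
    hw.integrable k (hψi.comp_sub_right _)
  have e1 : ∀ q, w k q * (((k + 1 : ℕ) : ℝ) ^ 2 * (ψ (q + hk • v) + ψ (q - hk • v) - 2 * ψ q))
      = ((k + 1 : ℕ) : ℝ) ^ 2 * (w k q * ψ (q - (-(hk • v))) + w k q * ψ (q - hk • v)
        - 2 * (w k q * ψ q)) := by
    intro q; rw [sub_neg_eq_add]; ring
  have e2 : ∀ q, ((k + 1 : ℕ) : ℝ) ^ 2 * (w k (q + hk • v) + w k (q - hk • v) - 2 * w k q) * ψ q
      = ((k + 1 : ℕ) : ℝ) ^ 2 * (w k (q + -(hk • v)) * ψ q + w k (q + hk • v) * ψ q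
        - 2 * (w k q * ψ q)) := by
    intro q; rw [← sub_eq_add_neg]; ring
  simp only [e1, e2]
  rw [integral_const_mul, integral_const_mul, int_comb (h3 _) (h3 _) h2, int_comb (h1 _) (h1 _) h2,
    translate_int, translate_int]


lemma gIdx_dist {d : ℕ} (K : ℕ) (hK : 1 ≤ K) (p q : SpT d) (h : gIdx K p = gIdx K q) :
    dist p q ≤ (K : ℝ)⁻¹ * (d + 1) := by
  have hK0 : (0 : ℝ) < K := by exact_mod_cast hK
  have key : ∀ a b : ℝ, ⌊(K : ℝ) * a⌋ = ⌊(K : ℝ) * b⌋ → |a - b| ≤ (K : ℝ)⁻¹ := by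
    intro a b hab
    have := Int.abs_sub_lt_one_of_floor_eq_floor hab
    rw [← mul_sub, abs_mul, abs_of_pos hK0] at this
    rw [← one_div, le_div_iff₀ hK0]
    linarith
  have h1 : ⌊(K : ℝ) * p.1⌋ = ⌊(K : ℝ) * q.1⌋ := congrArg Prod.fst h
  have h2 : ∀ j, ⌊(K : ℝ) * p.2 j⌋ = ⌊(K : ℝ) * q.2 j⌋ := fun j => congrFun (congrArg Prod.snd h) j
  have hd0 : (0 : ℝ) ≤ d := by positivity
  have hKi : 0 < (K : ℝ)⁻¹ := by positivity
  rw [Prod.dist_eq, max_le_iff]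
  constructor
  · rw [Real.dist_eq]
    refine (key _ _ h1).trans ?_
    nlinarith
  · rw [dist_eq_norm]
    have h3 : ‖p.2 - q.2‖ ^ 2 ≤ ((K : ℝ)⁻¹ * (d + 1)) ^ 2 := by
      rw [EuclideanSpace.norm_sq_eq]
      calc ∑ j, ‖(p.2 - q.2) j‖ ^ 2 ≤ ∑ j : Fin d, ((K : ℝ)⁻¹) ^ 2 := by
            refine Finset.sum_le_sum fun j _ => ?_
            have := key _ _ (h2 j)
            rw [Real.norm_eq_abs, PiLp.sub_apply]
            gcongr
        _ = d * ((K : ℝ)⁻¹) ^ 2 := by simp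
        _ ≤ _ := by
            rw [mul_pow, mul_comm]
            gcongr
            nlinarith
    exact abs_le_of_sq_le_sq' h3 (by positivity) |>.2

lemma cellAvg_near {d : ℕ} (K : ℕ) (hK : 1 ≤ K) (ψ : SpT d → ℝ) (hψ : Integrable ψ) (p : SpT d)
    (c δ : ℝ) (h : ∀ s, gIdx K s = gIdx K p → |ψ s - c| ≤ δ) : |cellAvg K ψ p - c| ≤ δ := by
  have hK0 : (0 : ℝ) < K := by exact_mod_cast hK
  have hv := volume_gIdx K hK (gIdx K p)
  have hr : volume.real ((gIdx K) ⁻¹' {gIdx K p}) = ((K : ℝ) ^ (d + 1))⁻¹ := by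
    rw [Measure.real, hv, ENNReal.toReal_ofReal (by positivity)]
  have hfin : volume ((gIdx K) ⁻¹' {gIdx K p}) < ⊤ := by rw [hv]; exact ENNReal.ofReal_lt_top
  have h1 := norm_setIntegral_le_of_norm_le_const (f := fun s => ψ s - c) (C := δ) hfin
    (fun s hs => h s hs)
  rw [integral_sub hψ.integrableOn (integrableOn_const hfin.ne), setIntegral_const, hr] at h1
  have h2 : cellAvg K ψ p - c = (K : ℝ) ^ (d + 1) *
      ((∫ s in (gIdx K) ⁻¹' {gIdx K p}, ψ s) - ((K : ℝ) ^ (d + 1))⁻¹ • c) := by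
    rw [cellAvg, smul_eq_mul]
    field_simp
  rw [h2, abs_mul, abs_of_pos (by positivity)]
  calc _ ≤ (K : ℝ) ^ (d + 1) * (δ * ((K : ℝ) ^ (d + 1))⁻¹) :=
        mul_le_mul_of_nonneg_left h1 (by positivity)
    _ = δ := by field_simp

lemma measurable_cellAvg {d : ℕ} (K : ℕ) (ψ : SpT d → ℝ) : Measurable (cellAvg K ψ) := by
  have : cellAvg K ψ = (fun n => (K : ℝ) ^ (d + 1) * ∫ p in (gIdx K) ⁻¹' {n}, ψ p) ∘ gIdx K := rfl
  rw [this]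
  exact Measurable.comp (measurable_of_countable _) (measurable_gIdx K)

lemma cellAvg_swap {d : ℕ} (K : ℕ) (hK : 1 ≤ K) (f ψ : SpT d → ℝ) (C : Set (SpT d))
    (hC : MeasurableSet C)
    (hf : IntegrableOn f C) (hψ : Integrable ψ) (hfm : Measurable f) (hψm : Measurable ψ)
    (hCψ : ∀ p q, gIdx K p = gIdx K q → ψ q ≠ 0 → p ∈ C) :
    ∫ q, cellAvg K f q * ψ q = ∫ p, C.indicator f p * cellAvg K ψ p := by
  classical
  let F : SpT d → SpT d → ℝ := fun q p =>
    if gIdx K p = gIdx K q then C.indicator f p * ψ q else 0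
  have hmeas : MeasurableSet {x : SpT d × SpT d | gIdx K x.2 = gIdx K x.1} :=
    measurableSet_eq_fun ((measurable_gIdx K).comp measurable_snd)
      ((measurable_gIdx K).comp measurable_fst)
  have hfi : Integrable (C.indicator f) := (integrable_indicator_iff hC).2 hf
  have hFi : Integrable (Function.uncurry F) (volume.prod volume) := by
    refine Integrable.mono (hψ.mul_prod hfi) ?_ ?_
    · refine Measurable.aestronglyMeasurable ?_
      exact Measurable.ite hmeas (((hfm.indicator hC).comp measurable_snd).mul
        (hψm.comp measurable_fst)) measurable_const
    · refine Filter.Eventually.of_forall fun x => ?_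
      simp only [Function.uncurry, F]
      split_ifs
      · rw [mul_comm]
      · rw [norm_zero]; exact norm_nonneg _
  have h1 : ∀ q, ∫ p, F q p = (∫ p in (gIdx K) ⁻¹' {gIdx K q}, f p) * ψ q := by
    intro q
    rw [← integral_mul_const, ← integral_indicator (measurableSet_gIdx K _)]
    refine integral_congr_ae (Filter.Eventually.of_forall fun p => ?_)
    simp only [F, Set.indicator_apply, Set.mem_preimage, Set.mem_singleton_iff]
    split_ifs with h2 h3
    · rfl
    · by_cases h4 : ψ q = 0
      · rw [h4]; simp
      · exact absurd (hCψ p q h2 h4) h3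
    · rfl
  have h2 : ∀ p, ∫ q, F q p = C.indicator f p * (∫ q in (gIdx K) ⁻¹' {gIdx K p}, ψ q) := by
    intro p
    rw [← integral_const_mul, ← integral_indicator (measurableSet_gIdx K _)]
    refine integral_congr_ae (Filter.Eventually.of_forall fun q => ?_)
    simp only [F]
    rw [Set.indicator_apply (gIdx K ⁻¹' {gIdx K p})]
    simp only [Set.mem_preimage, Set.mem_singleton_iff, eq_comm (a := gIdx K p)]
  have h3 := integral_integral_swap hFi
  simp only [h1, h2] at h3
  have h4 : ∀ q, cellAvg K f q * ψ q =
      (K : ℝ) ^ (d + 1) * ((∫ p in (gIdx K) ⁻¹' {gIdx K q}, f p) * ψ q) := fun q => by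
    rw [cellAvg]; ring
  have h5 : ∀ p, C.indicator f p * cellAvg K ψ p =
      (K : ℝ) ^ (d + 1) * (C.indicator f p * ∫ q in (gIdx K) ⁻¹' {gIdx K p}, ψ q) := fun q => by
    rw [cellAvg]; ring
  simp only [h4, h5]
  rw [integral_const_mul, integral_const_mul, h3]

lemma cellAvg_lim {d : ℕ} (f : SpT d → ℝ)
    (hfm : Measurable f) (hf0 : ∀ q, 0 ≤ f q) (hfi : Integrable (fun q => f q ^ (d + 1)))
    (ψ : SpT d → ℝ) (hψ : Continuous ψ) (hψc : HasCompactSupport ψ) :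
    Filter.Tendsto (fun k : ℕ => ∫ q, cellAvg (k + 1) f q * ψ q) Filter.atTop
      (nhds (∫ q, f q * ψ q)) := by
  classical
  have hψi : Integrable ψ := hψ.integrable_of_hasCompactSupport hψc
  set C := Metric.cthickening ((d : ℝ) + 1) (tsupport ψ) with hC
  have hCc : IsCompact C := hψc.isCompact.cthickening
  have hCm : MeasurableSet C := hCc.isClosed.measurableSet
  have hfC : IntegrableOn f C := integrableOn_cell 1 le_rfl f hfm hf0 hfi C hCc.measure_lt_top.ne
  have hsw : ∀ k : ℕ, ∫ q, cellAvg (k + 1) f q * ψ q = ∫ p, C.indicator f p * cellAvg (k + 1) ψ p := by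
    intro k
    refine cellAvg_swap (k + 1) (by omega) f ψ C hCm hfC hψi hfm hψ.measurable ?_
    intro p q hpq hq
    refine Metric.mem_cthickening_of_dist_le p q _ _ (subset_tsupport ψ hq) ?_
    exact (gIdx_dist (k + 1) (by omega) p q hpq).trans (hseq_le k _ (by positivity))
  simp only [hsw]
  have hlim : ∫ q, f q * ψ q = ∫ p, C.indicator f p * ψ p := by
    refine integral_congr_ae (Filter.Eventually.of_forall fun q => ?_)
    simp only [Set.indicator_apply]
    split_ifs with h
    · rfl
    · have : ψ q = 0 := by
        by_contra hne
        exact h (Metric.self_subset_cthickening _ (subset_tsupport ψ hne))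
      rw [this]; simp
  rw [hlim]
  obtain ⟨S, hS⟩ := hψ.bounded_above_of_compact_support hψc
  have hS' : ∀ k p, |cellAvg (k + 1) ψ p| ≤ S := by
    intro k p
    have := cellAvg_near (k + 1) (by omega) ψ hψi p 0 S (fun s _ => by rw [sub_zero]; exact hS s)
    rwa [sub_zero] at this
  refine tendsto_integral_of_dominated_convergence (fun p => ‖C.indicator f p‖ * S) ?_ ?_ ?_ ?_
  · intro k
    exact ((hfm.indicator hCm).mul (measurable_cellAvg _ _)).aestronglyMeasurable
  · exact ((integrable_indicator_iff hCm).2 hfC).norm.mul_const S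
  · intro k
    refine Filter.Eventually.of_forall fun p => ?_
    rw [norm_mul]
    exact mul_le_mul_of_nonneg_left (hS' k p) (norm_nonneg _)
  · refine Filter.Eventually.of_forall fun p => Filter.Tendsto.const_mul _ ?_
    rw [Metric.tendsto_nhds]
    intro ε hε
    have hcp := Metric.continuous_iff.1 hψ p (ε / 2) (by positivity)
    obtain ⟨δ, hδ, hδ'⟩ := hcp
    filter_upwards [(hseq_tendsto ((d : ℝ) + 1)).eventually (gt_mem_nhds hδ)] with k hk
    rw [Real.dist_eq]
    refine lt_of_le_of_lt (cellAvg_near (k + 1) (by omega) ψ hψi p (ψ p) (ε / 2) fun s hs => ?_)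
      (by linarith)
    have := hδ' s (lt_of_le_of_lt (gIdx_dist (k + 1) (by omega) s p hs) hk)
    exact this.le

lemma WeakLim.int_shift {d : ℕ} {U : Filter ℕ} {w : ℕ → SpT d → ℝ} {M : ℝ} {ζ : SpT d → ℝ}
    (hw : WeakLim U w M ζ) (k : ℕ) {ψ : SpT d → ℝ} (hψ : Integrable ψ) (u : SpT d) :
    Integrable fun q => w k (q + u) * ψ q :=
  hψ.bdd_mul (c := M) ((hw.meas k).comp (measurable_add_const _)).aestronglyMeasurable
      (Filter.Eventually.of_forall fun q => hw.bdd k _)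

lemma WeakLim.int_d1 {d : ℕ} {U : Filter ℕ} {w : ℕ → SpT d → ℝ} {M : ℝ} {ζ : SpT d → ℝ}
    (hw : WeakLim U w M ζ) (k : ℕ) {ψ : SpT d → ℝ} (hψ : Integrable ψ) (u : SpT d) (c : ℝ) :
    Integrable fun q => c * (w k (q + u) - w k q) * ψ q := by
  have := ((hw.int_shift k hψ u).sub (hw.integrable k hψ)).const_mul c
  refine this.congr (Filter.Eventually.of_forall fun q => ?_)
  simp only [Pi.sub_apply]
  ring

lemma WeakLim.int_d2 {d : ℕ} {U : Filter ℕ} {w : ℕ → SpT d → ℝ} {M : ℝ} {ζ : SpT d → ℝ}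
    (hw : WeakLim U w M ζ) (k : ℕ) {ψ : SpT d → ℝ} (hψ : Integrable ψ) (u : SpT d) (c : ℝ) :
    Integrable fun q => c * (w k (q + u) + w k (q - u) - 2 * w k q) * ψ q := by
  have := (((hw.int_shift k hψ u).add (hw.int_shift k hψ (-u))).sub
    ((hw.integrable k hψ).const_mul 2)).const_mul c
  refine this.congr (Filter.Eventually.of_forall fun q => ?_)
  simp only [Pi.sub_apply, Pi.add_apply, ← sub_eq_add_neg]
  ring

/-- The weak inequalities satisfied by the limit. -/
lemma weak_sol {d : ℕ} (hd : 1 ≤ d) (f : SpT d → ℝ)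
    (hfm : Measurable f) (hf0 : ∀ q, 0 ≤ f q) (hfi : Integrable (fun q => f q ^ (d + 1)))
    (M : ℝ) (hM0 : 0 ≤ M) (hM : 2 * (12 * d : ℝ) ^ d * ∫ q, f q ^ (d + 1) ≤ M ^ (d + 1)) :
    ∃ (U : Ultrafilter ℕ) (w : ℕ → SpT d → ℝ) (ζ : SpT d → ℝ),
      WeakLim (U : Filter ℕ) w M ζ ∧ (∀ k q, w k q ≤ 0) ∧ (∀ k q, -M ≤ w k q) ∧
      (∀ k x, Monotone fun t => w k (t, x)) ∧
      (∀ ψ : SpT d → ℝ, ContDiff ℝ (⊤ : ℕ∞) ψ → HasCompactSupport ψ → (∀ q, 0 ≤ ψ q) →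
        0 ≤ ∫ q, ζ q * dv ψ (-(1, 0)) q) ∧
      (∀ ψ : SpT d → ℝ, ContDiff ℝ (⊤ : ℕ∞) ψ → HasCompactSupport ψ → (∀ q, 0 ≤ ψ q) →
        (∀ q, ψ q ≠ 0 → ‖q.2‖ < 5) → ∀ l : Fin d → ℤ,
        0 ≤ ∫ q, ζ q * dv (dv ψ (0, lv l)) (0, lv l) q) ∧
      (∀ ψ : SpT d → ℝ, ContDiff ℝ (⊤ : ℕ∞) ψ → HasCompactSupport ψ → (∀ q, 0 ≤ ψ q) →
        (∀ q, ψ q ≠ 0 → 0 ≤ q.1 ∧ ‖q.2‖ < 5) →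
        ∀ B : Fin d → Fin d → ℤ, (Matrix.of B).det ≠ 0 →
        ∀ lam : Fin d → ℝ, (∀ i, 0 < lam i) → ∀ θ : ℝ, 0 ≤ θ → θ ^ (d + 1) ≤ ∏ i, lam i →
        θ * ∫ q, f q * ψ q ≤ (∫ q, ζ q * dv ψ (-(1, 0)) q) +
          ∑ i, lam i * ∫ q, ζ q * dv (dv ψ (0, lv (B i))) (0, lv (B i)) q) := by
  choose w hwm hw0 hwM hwt hws hwf using fun k : ℕ =>
    discrete_sol hd f hfm hf0 hfi M hM0 hM (k + 1) (by omega)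
  have hU : ((Filter.hyperfilter ℕ : Ultrafilter ℕ) : Filter ℕ) ≤ Filter.atTop := by
    rw [← Nat.cofinite_eq_atTop]; exact Filter.hyperfilter_le_cofinite
  set U := Filter.hyperfilter ℕ
  have hwb : ∀ k q, |w k q| ≤ M := fun k q => abs_le.2 ⟨hwM k q, (hw0 k q).trans hM0⟩
  obtain ⟨ζ, hζ, hlim⟩ := weak_limit U w M hwm hwb
  have hW : WeakLim (U : Filter ℕ) w M ζ := ⟨hwm, hwb, hζ, hlim⟩
  have hev : ∀ R : ℝ, ∀ᶠ k : ℕ in (U : Filter ℕ), R < ((k + 1 : ℕ) : ℝ) := fun R =>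
    hU ((Filter.tendsto_add_atTop_nat 1).eventually
      (tendsto_natCast_atTop_atTop.eventually_gt_atTop R))
  have hevl : ∀ l : Fin d → ℤ, ∀ᶠ k : ℕ in (U : Filter ℕ), ∀ j, |l j| ≤ ((k + 1 : ℕ) : ℤ) := by
    intro l
    filter_upwards [hev (∑ j, |(l j : ℝ)|)] with k hk j
    have := Finset.single_le_sum (f := fun j => |(l j : ℝ)|) (fun i _ => abs_nonneg _) (Finset.mem_univ j)
    have h2 : |(l j : ℝ)| ≤ ((k + 1 : ℕ) : ℝ) := this.trans hk.le
    exact_mod_cast h2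
  have esp : ∀ (k : ℕ) (q : SpT d) (l : Fin d → ℤ), w k (q + ((k + 1 : ℕ) : ℝ)⁻¹ • ((0, lv l) : SpT d)) +
      w k (q - ((k + 1 : ℕ) : ℝ)⁻¹ • ((0, lv l) : SpT d)) - 2 * w k q
      = sD2 (w k) q.1 q.2 (((k + 1 : ℕ) : ℝ)⁻¹ • lv l) := by
    intro k q l
    obtain ⟨t, x⟩ := q
    simp [sD2]
  have eti : ∀ (k : ℕ) (q : SpT d), q + ((k + 1 : ℕ) : ℝ)⁻¹ • ((1, 0) : SpT d)
      = (q.1 + ((k + 1 : ℕ) : ℝ)⁻¹, q.2) := by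
    intro k q
    obtain ⟨t, x⟩ := q
    simp
  refine ⟨U, w, ζ, hW, hw0, hwM, hwt, ?_, ?_, ?_⟩
  · intro ψ hψ hψc hψ0
    refine ge_of_tendsto (lim_diff1 hU hW ψ hψ hψc (1, 0)) (Filter.Eventually.of_forall fun k => ?_)
    refine integral_nonneg fun q => mul_nonneg (mul_nonneg (by positivity) ?_) (hψ0 q)
    rw [eti, sub_nonneg]
    have := hwt k q.2 (show q.1 ≤ q.1 + ((k + 1 : ℕ) : ℝ)⁻¹ by
      have : (0 : ℝ) < ((k + 1 : ℕ) : ℝ)⁻¹ := by positivity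
      linarith)
    exact this
  · intro ψ hψ hψc hψ0 hs l
    refine ge_of_tendsto (lim_diff2 hU hW ψ hψ hψc (0, lv l)) ?_
    filter_upwards [hevl l] with k hk
    refine integral_nonneg fun q => ?_
    simp only [Pi.zero_apply]
    rw [esp]
    by_cases h : ψ q = 0
    · rw [h, mul_zero]
    · exact mul_nonneg (mul_nonneg (by positivity) (hws k q.1 q.2 (hs q h) l hk)) (hψ0 q)
  · intro ψ hψ hψc hψ0 hs B hB lam hlam θ hθ hθl
    have hψi : Integrable ψ := hψ.continuous.integrable_of_hasCompactSupport hψc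
    have hL : Filter.Tendsto (fun k : ℕ => θ * ∫ q, cellAvg (k + 1) f q * ψ q) U
        (nhds (θ * ∫ q, f q * ψ q)) :=
      ((cellAvg_lim f hfm hf0 hfi ψ hψ.continuous hψc).mono_left hU).const_mul θ
    have hR := (lim_diff1 hU hW ψ hψ hψc (1, 0)).add
      (tendsto_finsetSum Finset.univ fun i (_ : i ∈ Finset.univ) =>
        (lim_diff2 hU hW ψ hψ hψc (0, lv (B i))).const_mul (lam i))
    refine le_of_tendsto_of_tendsto hL hR ?_
    obtain ⟨R, hRb⟩ := hψc.isCompact.isBounded.exists_norm_le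
    have hevB : ∀ᶠ k : ℕ in (U : Filter ℕ), ∀ i j, |B i j| ≤ ((k + 1 : ℕ) : ℤ) :=
      Filter.eventually_all.2 fun i => hevl (B i)
    filter_upwards [hev R, hevB] with k hkR hkB
    have hi1 := hW.int_d1 k hψi (((k + 1 : ℕ) : ℝ)⁻¹ • ((1, 0) : SpT d)) ((k + 1 : ℕ) : ℝ)
    have hi2 := fun i => (hW.int_d2 k hψi (((k + 1 : ℕ) : ℝ)⁻¹ • ((0, lv (B i)) : SpT d))
      (((k + 1 : ℕ) : ℝ) ^ 2)).const_mul (lam i)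
    have hi3 := integrable_finset_sum Finset.univ fun i (_ : i ∈ Finset.univ) => hi2 i
    simp only [← integral_const_mul]
    rw [← integral_finset_sum Finset.univ fun i _ => hi2 i, ← integral_add hi1 hi3]
    refine integral_mono_of_nonneg ?_ (hi1.add hi3) ?_
    · exact Filter.Eventually.of_forall fun q =>
        mul_nonneg hθ (mul_nonneg (cellAvg_nonneg _ f hf0 q) (hψ0 q))
    · refine Filter.Eventually.of_forall fun q => ?_
      simp only [Pi.add_apply, esp, eti]
      by_cases h : ψ q = 0
      · simp [h]
      · obtain ⟨ht, hx⟩ := hs q h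
        have hq := hRb q (subset_tsupport ψ h)
        have htk : q.1 < ((k + 1 : ℕ) : ℝ) :=
          lt_of_le_of_lt ((le_abs_self _).trans ((norm_fst_le q).trans hq)) hkR
        have := mul_le_mul_of_nonneg_right
          (hwf k q.1 q.2 ht htk hx B hB hkB lam hlam θ hθ hθl) (hψ0 q)
        rw [add_mul, Finset.sum_mul] at this
        simp only [mul_assoc] at this ⊢
        exact this

/-- Convolution of a locally integrable function with a test function. -/
noncomputable def cv {d : ℕ} (ζ κ : SpT d → ℝ) (q : SpT d) : ℝ := ∫ s, ζ s * κ (q - s)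

lemma cv_eq {d : ℕ} (ζ κ : SpT d → ℝ) :
    cv ζ κ = convolution ζ κ (ContinuousLinearMap.mul ℝ ℝ) volume := by
  funext q
  rw [cv, convolution_def]
  rfl

lemma cv_contDiff {d : ℕ} {ζ κ : SpT d → ℝ} (hζ : LocallyIntegrable ζ)
    (hκ : ContDiff ℝ (⊤ : ℕ∞) κ) (hκc : HasCompactSupport κ) : ContDiff ℝ (⊤ : ℕ∞) (cv ζ κ) := by
  rw [cv_eq]
  exact hκc.contDiff_convolution_right _ hζ hκ

lemma cv_dv {d : ℕ} {ζ κ : SpT d → ℝ} (hζ : LocallyIntegrable ζ)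
    (hκ : ContDiff ℝ (⊤ : ℕ∞) κ) (hκc : HasCompactSupport κ) (e : SpT d) :
    dv (cv ζ κ) e = cv ζ (dv κ e) := by
  funext q
  have h1 : ContDiff ℝ 1 κ := hκ.of_le (by exact_mod_cast le_top)
  have h := hκc.hasFDerivAt_convolution_right (ContinuousLinearMap.mul ℝ ℝ) hζ h1 q
  rw [dv, cv_eq, h.fderiv, convolution_precompR_apply _ hζ (hκc.fderiv ℝ)
    (h1.continuous_fderiv (by simp)), cv_eq]
  rfl

lemma refl_contDiff {d : ℕ} {κ : SpT d → ℝ} (hκ : ContDiff ℝ (⊤ : ℕ∞) κ) (q : SpT d) :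
    ContDiff ℝ (⊤ : ℕ∞) (fun s => κ (q - s)) := hκ.comp (contDiff_const.sub contDiff_id)

lemma refl_compact {d : ℕ} {κ : SpT d → ℝ} (hκ : HasCompactSupport κ) (q : SpT d) :
    HasCompactSupport (fun s => κ (q - s)) :=
  hκ.comp_homeomorph (Homeomorph.subLeft q)

lemma refl_dv {d : ℕ} {κ : SpT d → ℝ} (hκ : ContDiff ℝ (⊤ : ℕ∞) κ) (q e : SpT d) :
    dv (fun s => κ (q - s)) e = fun s => - dv κ e (q - s) := by
  funext s
  have h1 : HasFDerivAt (fun s : SpT d => q - s) (-(ContinuousLinearMap.id ℝ (SpT d))) s :=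
    (hasFDerivAt_id s).const_sub q
  have h2 := (hκ.differentiable (by simp) (q - s)).hasFDerivAt.comp s h1
  have h3 : fderiv ℝ (fun s => κ (q - s)) s = _ := h2.fderiv
  rw [dv, h3]
  simp [dv]

lemma refl_dv2 {d : ℕ} {κ : SpT d → ℝ} (hκ : ContDiff ℝ (⊤ : ℕ∞) κ) (q e : SpT d) :
    dv (dv (fun s => κ (q - s)) e) e = fun s => dv (dv κ e) e (q - s) := by
  have h := refl_dv (κ := fun r => - dv κ e r) (dv_contDiff hκ e).neg q e
  rw [refl_dv hκ, h]
  funext s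
  have h2 : dv (fun r => - dv κ e r) e (q - s) = - dv (dv κ e) e (q - s) := by
    rw [dv, fderiv_fun_neg]; rfl
  rw [h2, neg_neg]

lemma dv_dv_eq {X : Type*} [NormedAddCommGroup X] [NormedSpace ℝ X] {G : X → ℝ}
    (hG : ContDiff ℝ (⊤ : ℕ∞) G) (u v q : X) :
    dv (dv G v) u q = (fderiv ℝ (fderiv ℝ G) q u) v := by
  have h := (hG.fderiv_right (m := ((⊤ : ℕ∞) : WithTop ℕ∞)) (by exact_mod_cast le_rfl)).differentiable
    (by simp) q
  have h2 := h.hasFDerivAt.clm_apply (hasFDerivAt_const v q)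
  have h3 : fderiv ℝ (dv G v) q = _ := h2.fderiv
  rw [dv, h3]
  simp

lemma lattice_approx {d : ℕ} (x : EuclideanSpace ℝ (Fin d)) :
    Filter.Tendsto (fun k : ℕ => ((k + 1 : ℕ) : ℝ)⁻¹ • lv (fun j => ⌊((k + 1 : ℕ) : ℝ) * x j⌋))
      Filter.atTop (nhds x) := by
  rw [tendsto_iff_dist_tendsto_zero]
  refine squeeze_zero (fun _ => dist_nonneg) (fun k => ?_) (hseq_tendsto ((d : ℝ) + 1))
  have hk : (0 : ℝ) < ((k + 1 : ℕ) : ℝ) := by positivity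
  have h := gIdx_dist (d := d) (k + 1) (by omega)
    (0, ((k + 1 : ℕ) : ℝ)⁻¹ • lv (fun j => ⌊((k + 1 : ℕ) : ℝ) * x j⌋)) (0, x) (by
      rw [gIdx, gIdx]
      refine Prod.ext rfl ?_
      funext j
      simp only [lv, PiLp.smul_apply, smul_eq_mul]
      rw [mul_inv_cancel_left₀ hk.ne', Int.floor_intCast])
  rw [Prod.dist_eq] at h
  exact (le_max_right _ _).trans h

lemma psd_of_lattice {d : ℕ} {G : SpT d → ℝ} (hG : ContDiff ℝ (⊤ : ℕ∞) G) (q : SpT d)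
    (h : ∀ l : Fin d → ℤ, 0 ≤ dv (dv G (0, lv l)) (0, lv l) q) (x : EuclideanSpace ℝ (Fin d)) :
    0 ≤ dv (dv G (0, x)) (0, x) q := by
  have hc : Continuous fun x : EuclideanSpace ℝ (Fin d) => dv (dv G (0, x)) (0, x) q := by
    simp only [dv_dv_eq hG]
    fun_prop
  refine ge_of_tendsto ((hc.tendsto x).comp (lattice_approx x)) (Filter.Eventually.of_forall fun k => ?_)
  simp only [Function.comp]
  have e : ∀ (c : ℝ) (y : EuclideanSpace ℝ (Fin d)),
      dv (dv G (0, c • y)) (0, c • y) q = c * (c * dv (dv G (0, y)) (0, y) q) := by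
    intro c y
    have : ((0, c • y) : SpT d) = c • ((0, y) : SpT d) := by simp
    rw [dv_dv_eq hG, dv_dv_eq hG, this]
    simp only [map_smul, ContinuousLinearMap.smul_apply, smul_eq_mul]
  rw [e]
  have := h (fun j => ⌊((k + 1 : ℕ) : ℝ) * x j⌋)
  positivity

/-- Weak inequalities in convolution form. -/
lemma conv_sol {d : ℕ} (hd : 1 ≤ d) (f : SpT d → ℝ)
    (hfm : Measurable f) (hf0 : ∀ q, 0 ≤ f q) (hfi : Integrable (fun q => f q ^ (d + 1)))
    (M : ℝ) (hM0 : 0 ≤ M) (hM : 2 * (12 * d : ℝ) ^ d * ∫ q, f q ^ (d + 1) ≤ M ^ (d + 1)) :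
    ∃ (U : Ultrafilter ℕ) (w : ℕ → SpT d → ℝ) (ζ : SpT d → ℝ),
      WeakLim (U : Filter ℕ) w M ζ ∧ (∀ k q, w k q ≤ 0) ∧ (∀ k q, -M ≤ w k q) ∧
      (∀ k x, Monotone fun t => w k (t, x)) ∧
      (∀ κ : SpT d → ℝ, ContDiff ℝ (⊤ : ℕ∞) κ → HasCompactSupport κ → (∀ q, 0 ≤ κ q) →
        ∀ q, 0 ≤ dv (cv ζ κ) (1, 0) q) ∧
      (∀ κ : SpT d → ℝ, ContDiff ℝ (⊤ : ℕ∞) κ → HasCompactSupport κ → (∀ q, 0 ≤ κ q) →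
        ∀ q, (∀ s, κ (q - s) ≠ 0 → ‖s.2‖ < 5) → ∀ x, 0 ≤ dv (dv (cv ζ κ) (0, x)) (0, x) q) ∧
      (∀ κ : SpT d → ℝ, ContDiff ℝ (⊤ : ℕ∞) κ → HasCompactSupport κ → (∀ q, 0 ≤ κ q) →
        ∀ q, (∀ s, κ (q - s) ≠ 0 → 0 ≤ s.1 ∧ ‖s.2‖ < 5) →
        ∀ B : Fin d → Fin d → ℤ, (Matrix.of B).det ≠ 0 →
        ∀ lam : Fin d → ℝ, (∀ i, 0 < lam i) → ∀ θ : ℝ, 0 ≤ θ → θ ^ (d + 1) ≤ ∏ i, lam i →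
        θ * cv f κ q ≤ dv (cv ζ κ) (1, 0) q +
          ∑ i, lam i * dv (dv (cv ζ κ) (0, lv (B i))) (0, lv (B i)) q) := by
  obtain ⟨U, w, ζ, hW, hw0, hwM, hwt, h1, h2, h3⟩ := weak_sol hd f hfm hf0 hfi M hM0 hM
  have et : ∀ κ : SpT d → ℝ, ContDiff ℝ (⊤ : ℕ∞) κ → HasCompactSupport κ → ∀ q,
      ∫ s, ζ s * dv (fun s => κ (q - s)) (-(1, 0)) s = dv (cv ζ κ) (1, 0) q := by
    intro κ hκ hκc q
    rw [refl_dv hκ, cv_dv hW.loc hκ hκc, cv]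
    refine integral_congr_ae (Filter.Eventually.of_forall fun s => ?_)
    simp only [dv, map_neg, neg_neg]
  have es : ∀ κ : SpT d → ℝ, ContDiff ℝ (⊤ : ℕ∞) κ → HasCompactSupport κ → ∀ q e,
      ∫ s, ζ s * dv (dv (fun s => κ (q - s)) e) e s = dv (dv (cv ζ κ) e) e q := by
    intro κ hκ hκc q e
    rw [refl_dv2 hκ, cv_dv hW.loc hκ hκc, cv_dv hW.loc (dv_contDiff hκ e) (dv_compact hκc e), cv]
  refine ⟨U, w, ζ, hW, hw0, hwM, hwt, ?_, ?_, ?_⟩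
  · intro κ hκ hκc hκ0 q
    rw [← et κ hκ hκc]
    exact h1 _ (refl_contDiff hκ q) (refl_compact hκc q) fun s => hκ0 _
  · intro κ hκ hκc hκ0 q hs x
    refine psd_of_lattice (cv_contDiff hW.loc hκ hκc) q (fun l => ?_) x
    rw [← es κ hκ hκc]
    exact h2 _ (refl_contDiff hκ q) (refl_compact hκc q) (fun s => hκ0 _) hs l
  · intro κ hκ hκc hκ0 q hs B hB lam hlam θ hθ hθl
    have := h3 _ (refl_contDiff hκ q) (refl_compact hκc q) (fun s => hκ0 _) hs B hB lam hlam θ hθ hθl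
    rw [et κ hκ hκc] at this
    simp only [es κ hκ hκc] at this
    exact this

lemma convex_of_psd {d : ℕ} {G : SpT d → ℝ} (hG : ContDiff ℝ (⊤ : ℕ∞) G) (t R : ℝ)
    (h : ∀ x : EuclideanSpace ℝ (Fin d), ‖x‖ < R → ∀ v, 0 ≤ dv (dv G (0, v)) (0, v) (t, x)) :
    ConvexOn ℝ (ball (0 : EuclideanSpace ℝ (Fin d)) R) (fun x => G (t, x)) := by
  refine ⟨convex_ball _ _, fun x hx y hy a b ha hb hab => ?_⟩
  let v : SpT d := (0, y - x)
  have hc : ConvexOn ℝ (Set.Icc (0 : ℝ) 1) (fun τ : ℝ => G ((t, x) + τ • v)) := by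
    refine convexOn_of_hasDerivWithinAt2_nonneg (f' := fun τ => dv G v ((t, x) + τ • v))
      (f'' := fun τ => dv (dv G v) v ((t, x) + τ • v)) (convex_Icc 0 1) ?_ ?_ ?_ ?_
    · exact fun τ _ => (dv_line hG _ v τ).continuousAt.continuousWithinAt
    · exact fun τ _ => (dv_line hG _ v τ).hasDerivWithinAt
    · exact fun τ _ => (dv_line (dv_contDiff hG v) _ v τ).hasDerivWithinAt
    · intro τ hτ
      rw [interior_Icc] at hτ
      have hm : x + τ • (y - x) ∈ ball (0 : EuclideanSpace ℝ (Fin d)) R := by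
        have := (convex_ball (0 : EuclideanSpace ℝ (Fin d)) R).add_smul_sub_mem hx hy
          ⟨hτ.1.le, hτ.2.le⟩
        exact this
      have e : ((t, x) : SpT d) + τ • v = (t, x + τ • (y - x)) := by simp [v]
      rw [e]
      exact h _ (mem_ball_zero_iff.1 hm) _
  have h2 := hc.2 (Set.left_mem_Icc.2 zero_le_one) (Set.right_mem_Icc.2 zero_le_one) ha hb hab
  have e1 : ((t, x) : SpT d) + (a • (0 : ℝ) + b • (1 : ℝ)) • v = (t, a • x + b • y) := by
    refine Prod.ext (by simp [v]) ?_
    have : a = 1 - b := by linarith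
    simp only [v, this, smul_eq_mul, mul_zero, mul_one, zero_add, Prod.snd_add, Prod.smul_snd]
    module
  have e2 : ((t, x) : SpT d) + (0 : ℝ) • v = (t, x) := by simp
  have e3 : ((t, x) : SpT d) + (1 : ℝ) • v = (t, y) := by simp [v]
  simp only [e1, e2, e3] at h2
  exact h2

/-- Bump functions shrinking to the origin. -/
noncomputable def bmp (d n : ℕ) : ContDiffBump (0 : SpT d) where
  rIn := (1 / 2) * ((n + 1 : ℕ) : ℝ)⁻¹
  rOut := ((n + 1 : ℕ) : ℝ)⁻¹ * 1
  rIn_pos := by positivity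
  rIn_lt_rOut := by
    have : (0 : ℝ) < ((n + 1 : ℕ) : ℝ)⁻¹ := by positivity
    linarith

/-- A precise representative of the weak limit. -/
lemma exists_rep {d : ℕ} {U : Ultrafilter ℕ} {w : ℕ → SpT d → ℝ} {M : ℝ} {ζ : SpT d → ℝ}
    (hW : WeakLim (U : Filter ℕ) w M ζ) (hw0 : ∀ k q, w k q ≤ 0) (hwM : ∀ k q, -M ≤ w k q)
    (h1 : ∀ κ : SpT d → ℝ, ContDiff ℝ (⊤ : ℕ∞) κ → HasCompactSupport κ → (∀ q, 0 ≤ κ q) →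
        ∀ q, 0 ≤ dv (cv ζ κ) (1, 0) q)
    (h2 : ∀ κ : SpT d → ℝ, ContDiff ℝ (⊤ : ℕ∞) κ → HasCompactSupport κ → (∀ q, 0 ≤ κ q) →
        ∀ q, (∀ s, κ (q - s) ≠ 0 → ‖s.2‖ < 5) → ∀ x, 0 ≤ dv (dv (cv ζ κ) (0, x)) (0, x) q) :
    ∃ z : SpT d → ℝ, (∀ᵐ q, z q = ζ q) ∧ (∀ q, z q ≤ 0) ∧ (∀ q, -M ≤ z q) ∧
      (∀ x, Monotone fun t => z (t, x)) ∧
      (∀ t, ConvexOn ℝ (ball (0 : EuclideanSpace ℝ (Fin d)) 4) (fun x => z (t, x))) := by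
  let κ : ℕ → SpT d → ℝ := fun n => (bmp d n).normed volume
  have hκ : ∀ n, ContDiff ℝ (⊤ : ℕ∞) (κ n) := fun n => (bmp d n).contDiff_normed
  have hκc : ∀ n, HasCompactSupport (κ n) := fun n => (bmp d n).hasCompactSupport_normed
  have hκ0 : ∀ n q, 0 ≤ κ n q := fun n q => (bmp d n).nonneg_normed q
  have hκi : ∀ n, Integrable (κ n) := fun n => (hκ n).continuous.integrable_of_hasCompactSupport (hκc n)
  have hκ1 : ∀ n q, ∫ s, κ n (q - s) = 1 := fun n q => by
    rw [integral_sub_left_eq_self (κ n) volume q]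
    exact (bmp d n).integral_normed
  have hκi' : ∀ n q, Integrable fun s => κ n (q - s) := fun n q => (hκi n).comp_sub_left q
  have hb : ∀ n q, cv ζ (κ n) q ∈ Set.Icc (-M) 0 := by
    intro n q
    have hl := hW.lim _ (refl_contDiff (hκ n) q).continuous (refl_compact (hκc n) q)
    refine isClosed_Icc.mem_of_tendsto hl (Filter.Eventually.of_forall fun k => ⟨?_, ?_⟩)
    · have := integral_mono ((hκi' n q).const_mul (-M)) (hW.integrable k (hκi' n q))
        (fun s => mul_le_mul_of_nonneg_right (hwM k s) (hκ0 n _))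
      rw [integral_const_mul, hκ1, mul_one] at this
      exact this
    · exact integral_nonpos fun s => mul_nonpos_of_nonpos_of_nonneg (hw0 k s) (hκ0 n _)
  have hU : ((Filter.hyperfilter ℕ : Ultrafilter ℕ) : Filter ℕ) ≤ Filter.atTop := by
    rw [← Nat.cofinite_eq_atTop]; exact Filter.hyperfilter_le_cofinite
  set V := Filter.hyperfilter ℕ
  have hex : ∀ q, ∃ L ∈ Set.Icc (-M) (0 : ℝ), Filter.Tendsto (fun n => cv ζ (κ n) q) V (nhds L) := by
    intro q
    obtain ⟨L, hL, hL'⟩ := isCompact_Icc.ultrafilter_le_nhds (V.map fun n => cv ζ (κ n) q)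
      (by
        rw [Ultrafilter.coe_map, Filter.le_principal_iff, Filter.mem_map]
        exact Filter.univ_mem' fun n => hb n q)
    exact ⟨L, hL, hL'⟩
  choose z hz hzl using hex
  have hrOut : Filter.Tendsto (fun n => (bmp d n).rOut) Filter.atTop (nhds 0) := hseq_tendsto 1
  refine ⟨z, ?_, fun q => (hz q).2, fun q => (hz q).1, ?_, ?_⟩
  · have := ContDiffBump.ae_convolution_tendsto_right_of_locallyIntegrable (μ := volume)
      (φ := bmp d) (l := Filter.atTop) (K := 2) hrOut
      (Filter.Eventually.of_forall fun n => by simp only [bmp]; linarith) hW.loc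
    filter_upwards [this] with q hq
    refine tendsto_nhds_unique (hzl q) ((hq.mono_left hU).congr fun n => ?_)
    rw [convolution_lsmul_swap, cv]
    refine integral_congr_ae (Filter.Eventually.of_forall fun s => ?_)
    simp only [smul_eq_mul, κ]
    ring
  · intro x t t' htt
    refine le_of_tendsto_of_tendsto (hzl (t, x)) (hzl (t', x)) (Filter.Eventually.of_forall fun n => ?_)
    have hd : ∀ τ : ℝ, HasDerivAt (fun τ : ℝ => cv ζ (κ n) ((0, x) + τ • (1, 0)))
      (dv (cv ζ (κ n)) (1, 0) ((0, x) + τ • (1, 0))) τ :=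
      fun τ => dv_line (cv_contDiff hW.loc (hκ n) (hκc n)) (0, x) (1, 0) τ
    have hm := monotone_of_hasDerivAt_nonneg hd (fun τ => h1 _ (hκ n) (hκc n) (hκ0 n) _)
    have := hm htt
    simpa using this
  · intro t
    have hcn : ∀ n, ConvexOn ℝ (ball (0 : EuclideanSpace ℝ (Fin d)) 4) (fun x => cv ζ (κ n) (t, x)) := by
      intro n
      refine convex_of_psd (cv_contDiff hW.loc (hκ n) (hκc n)) t 4 fun x hx v => ?_
      refine h2 _ (hκ n) (hκc n) (hκ0 n) _ (fun s hs => ?_) v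
      have hs' : (t, x) - s ∈ Function.support ((bmp d n).normed volume) := hs
      rw [ContDiffBump.support_normed_eq, mem_ball_zero_iff] at hs'
      have hr : (bmp d n).rOut ≤ 1 := hseq_le n 1 zero_le_one
      have h3 : ‖x - s.2‖ < 1 := lt_of_le_of_lt (norm_snd_le ((t, x) - s)) (lt_of_lt_of_le hs' hr)
      have h4 : ‖s.2‖ ≤ ‖x‖ + ‖x - s.2‖ := by
        have := norm_sub_le x (x - s.2)
        rwa [sub_sub_cancel] at this
      linarith
    refine ⟨convex_ball _ _, fun x hx y hy a b ha hb' hab => ?_⟩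
    exact le_of_tendsto_of_tendsto (hzl (t, a • x + b • y))
      (((hzl (t, x)).const_smul a).add ((hzl (t, y)).const_smul b))
      (Filter.Eventually.of_forall fun n => (hcn n).2 hx hy ha hb' hab)

/-- The rescaled mollifier. -/
noncomputable def mollK {d : ℕ} (ξ : SpT d → ℝ) (ε : ℝ) (r : SpT d) : ℝ :=
  (ε ^ (d + 1))⁻¹ * ξ (ε⁻¹ • r)

lemma stMollify_eq_cv {d : ℕ} (ξ : SpT d → ℝ) (ε : ℝ) (u : SpT d → ℝ) :
    stMollify ξ ε u = cv u (mollK ξ ε) := by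
  funext q
  rw [cv, ← integral_sub_left_eq_self (fun s => u s * mollK ξ ε (q - s)) volume q, stMollify]
  refine integral_congr_ae (Filter.Eventually.of_forall fun r => ?_)
  simp only [sub_sub_cancel, mollK]
  rfl

lemma cv_congr_ae {d : ℕ} {z ζ : SpT d → ℝ} (h : ∀ᵐ q, z q = ζ q) (κ : SpT d → ℝ) :
    cv z κ = cv ζ κ := by
  funext q
  refine integral_congr_ae ?_
  filter_upwards [h] with s hs
  rw [hs]

lemma mollK_props {d : ℕ} (ξ : SpT d → ℝ) (hξ : ContDiff ℝ (⊤ : ℕ∞) ξ) (hξ0 : ∀ r, 0 ≤ ξ r)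
    (hξs : tsupport ξ ⊆ Set.Ioo (-1 : ℝ) 0 ×ˢ ball (0 : EuclideanSpace ℝ (Fin d)) 1)
    (ε : ℝ) (hε : ε ∈ Set.Ioo (0 : ℝ) 2) :
    ContDiff ℝ (⊤ : ℕ∞) (mollK ξ ε) ∧ HasCompactSupport (mollK ξ ε) ∧ (∀ r, 0 ≤ mollK ξ ε r) ∧
    ∀ t : ℝ, 0 ≤ t → ∀ x ∈ ball (0 : EuclideanSpace ℝ (Fin d)) 2, ∀ s : SpT d,
      mollK ξ ε ((t, x) - s) ≠ 0 → 0 ≤ s.1 ∧ ‖s.2‖ < 5 := by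
  obtain ⟨he, he2⟩ := hε
  have hξc : HasCompactSupport ξ := by
    refine Metric.isCompact_of_isClosed_isBounded (isClosed_tsupport ξ) (Bornology.IsBounded.subset ?_ hξs)
    exact (Metric.isBounded_Ioo _ _).prod isBounded_ball
  refine ⟨?_, ?_, ?_, ?_⟩
  · exact contDiff_const.mul (hξ.comp (contDiff_const_smul _))
  · exact (hξc.comp_smul (inv_ne_zero he.ne')).mul_left
  · exact fun r => mul_nonneg (by positivity) (hξ0 _)
  · intro t ht x hx s hs
    have h1 : ξ (ε⁻¹ • ((t, x) - s)) ≠ 0 := fun h => hs (by rw [mollK, h, mul_zero])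
    obtain ⟨h2, h3⟩ := hξs (subset_tsupport ξ h1)
    have h4 : ε⁻¹ * (t - s.1) < 0 := h2.2
    have h5 : ε⁻¹ • (x - s.2) ∈ ball (0 : EuclideanSpace ℝ (Fin d)) 1 := h3
    rw [mem_ball_zero_iff, norm_smul, Real.norm_of_nonneg (by positivity), inv_mul_lt_iff₀ he] at h5
    rw [mem_ball_zero_iff] at hx
    have h6 : t - s.1 < 0 := by
      by_contra hc
      have := mul_nonneg (inv_nonneg.2 he.le) (not_lt.1 hc)
      linarith
    have h7 : ‖s.2‖ ≤ ‖x‖ + ‖x - s.2‖ := by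
      have := norm_sub_le x (x - s.2)
      rwa [sub_sub_cancel] at this
    exact ⟨by linarith, by linarith⟩

lemma deriv_slice {d : ℕ} {G : SpT d → ℝ} (hG : ContDiff ℝ (⊤ : ℕ∞) G) (t : ℝ)
    (x : EuclideanSpace ℝ (Fin d)) : deriv (fun s => G (s, x)) t = dv G (1, 0) (t, x) := by
  have h := (hG.differentiable (by simp) (t, x)).hasFDerivAt.comp_hasDerivAt t
    ((hasDerivAt_id t).prodMk (hasDerivAt_const t x))
  exact h.deriv

lemma fderiv_slice {d : ℕ} {G : SpT d → ℝ} (hG : ContDiff ℝ (⊤ : ℕ∞) G) (t : ℝ)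
    (x e : EuclideanSpace ℝ (Fin d)) : fderiv ℝ (fun v => G (t, v)) x e = dv G (0, e) (t, x) := by
  have h := (hG.differentiable (by simp) (t, x)).hasFDerivAt.comp x (hasFDerivAt_prodMk_right t x)
  have h2 : fderiv ℝ (fun v => G (t, v)) x = _ := h.fderiv
  rw [h2]
  simp [dv]

lemma quad_expand {d : ℕ} {G : SpT d → ℝ} (hG : ContDiff ℝ (⊤ : ℕ∞) G) (q : SpT d) (v : Fin d → ℝ) :
    ∑ i, ∑ j, v i * v j *
      dv (dv G (0, EuclideanSpace.single j 1)) (0, EuclideanSpace.single i 1) q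
    = dv (dv G (0, WithLp.toLp 2 v)) (0, WithLp.toLp 2 v) q := by
  have e : ((0, WithLp.toLp 2 v) : SpT d) = ∑ i, v i • ((0, EuclideanSpace.single i 1) : SpT d) := by
    refine Prod.ext ?_ ?_
    · simp [Prod.fst_sum]
    · rw [Prod.snd_sum]
      ext k
      simp [Finset.sum_apply, Pi.single_apply]
  simp only [dv_dv_eq hG]
  rw [e, map_sum]
  simp only [map_sum, map_smul, FunLike.coe_sum, Finset.sum_apply, FunLike.coe_smul, Pi.smul_apply, smul_eq_mul]
  rw [Finset.sum_comm]
  refine Finset.sum_congr rfl fun i _ => ?_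
  rw [Finset.mul_sum]
  refine Finset.sum_congr rfl fun j _ => ?_
  ring

/-- Theorem 4.3 of the paper (parabolic Aleksandrov-type construction): for nonnegative
`f ∈ L_{d+1}(C₂)` vanishing outside `C₂` there is a bounded nonpositive function `z` on
`C₄`, convex in `x` and nondecreasing in `t`, with
`∂_t z⁽ᵉ⁾ + a^{ij} D_{ij} z⁽ᵉ⁾ ≥ α (det a)^{1/(d+1)} f⁽ᵉ⁾` on `C₂` for every nonnegative
symmetric matrix `a`, and `|z| ≤ N_d ‖f‖_{L_{d+1}(C₂)}`. -/
theorem parabolic_aleksandrov (d : ℕ) (hd : 1 ≤ d) :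
    ∃ α : ℝ, 0 < α ∧ ∃ N : ℝ,
      ∀ f : ℝ × EuclideanSpace ℝ (Fin d) → ℝ, Measurable f → (∀ q, 0 ≤ f q) →
        (∀ q ∉ Set.Ici (0 : ℝ) ×ˢ ball (0 : EuclideanSpace ℝ (Fin d)) 2, f q = 0) →
        IntegrableOn (fun q => f q ^ (d + 1))
          (Set.Ici (0 : ℝ) ×ˢ ball (0 : EuclideanSpace ℝ (Fin d)) 2) →
        ∃ z : ℝ × EuclideanSpace ℝ (Fin d) → ℝ,
          (∀ q ∈ Set.Ici (0 : ℝ) ×ˢ ball (0 : EuclideanSpace ℝ (Fin d)) 4, z q ≤ 0) ∧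
          (∀ t : ℝ, 0 ≤ t →
            ConvexOn ℝ (ball (0 : EuclideanSpace ℝ (Fin d)) 4) (fun x => z (t, x))) ∧
          (∀ x ∈ ball (0 : EuclideanSpace ℝ (Fin d)) 4,
            MonotoneOn (fun t => z (t, x)) (Set.Ici (0 : ℝ))) ∧
          (∀ ξ : ℝ × EuclideanSpace ℝ (Fin d) → ℝ, ContDiff ℝ (⊤ : ℕ∞) ξ → (∀ r, 0 ≤ ξ r) →
            tsupport ξ ⊆ Set.Ioo (-1 : ℝ) 0 ×ˢ ball (0 : EuclideanSpace ℝ (Fin d)) 1 →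
            (∫ r, ξ r) = 1 →
            ∀ ε ∈ Set.Ioo (0 : ℝ) 2, ∀ a : Matrix (Fin d) (Fin d) ℝ, a.PosSemidef →
            ∀ t : ℝ, 0 ≤ t → ∀ x ∈ ball (0 : EuclideanSpace ℝ (Fin d)) 2,
              α * a.det ^ (((d : ℝ) + 1)⁻¹) * stMollify ξ ε f (t, x) ≤
                deriv (fun s => stMollify ξ ε z (s, x)) t +
                  ∑ i, ∑ j, a i j *
                    fderiv ℝ
                      (fun w =>
                        fderiv ℝ (fun v => stMollify ξ ε z (t, v)) w
                          (EuclideanSpace.single j 1))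
                      x (EuclideanSpace.single i 1)) ∧
          (∀ q ∈ Set.Ici (0 : ℝ) ×ˢ ball (0 : EuclideanSpace ℝ (Fin d)) 4,
            |z q| ≤ N * (∫ r in Set.Ici (0 : ℝ) ×ˢ ball (0 : EuclideanSpace ℝ (Fin d)) 2,
                f r ^ (d + 1)) ^ (((d : ℝ) + 1)⁻¹)) := by
  obtain ⟨c, hc, hlat⟩ := lattice_minor d hd
  have hroot : ∀ y : ℝ, 0 ≤ y → (y ^ (((d : ℝ) + 1)⁻¹)) ^ (d + 1) = y := by
    intro y hy
    have := Real.rpow_inv_natCast_pow hy (Nat.succ_ne_zero d)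
    rw [Nat.succ_eq_add_one] at this
    push_cast at this
    exact this
  refine ⟨c ^ (((d : ℝ) + 1)⁻¹), by positivity, (2 * (12 * d : ℝ) ^ d) ^ (((d : ℝ) + 1)⁻¹), ?_⟩
  intro f hfm hf0 hfs hfi
  set S := Set.Ici (0 : ℝ) ×ˢ ball (0 : EuclideanSpace ℝ (Fin d)) 2 with hS
  have hI : Integrable (fun q => f q ^ (d + 1)) := by
    refine (integrableOn_iff_integrable_of_support_subset ?_).1 hfi
    intro q hq
    by_contra hn
    exact hq (by simp [hfs q hn])
  have hIe : ∫ r in S, f r ^ (d + 1) = ∫ r, f r ^ (d + 1) :=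
    setIntegral_eq_integral_of_forall_compl_eq_zero fun q hq => by simp [hfs q hq]
  rw [hIe]
  have hI0 : 0 ≤ ∫ r, f r ^ (d + 1) := integral_nonneg fun q => pow_nonneg (hf0 q) _
  set M := (2 * (12 * d : ℝ) ^ d) ^ (((d : ℝ) + 1)⁻¹) * (∫ r, f r ^ (d + 1)) ^ (((d : ℝ) + 1)⁻¹)
    with hMdef
  have hM0 : 0 ≤ M := by positivity
  have hM : 2 * (12 * d : ℝ) ^ d * ∫ q, f q ^ (d + 1) ≤ M ^ (d + 1) := by
    rw [hMdef, mul_pow (_ ^ (((d : ℝ) + 1)⁻¹)), hroot _ (by positivity), hroot _ hI0]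
  obtain ⟨U, w, ζ, hW, hw0, hwM, -, h1, h2, h3⟩ := conv_sol hd f hfm hf0 hI M hM0 hM
  obtain ⟨z, hzζ, hz0, hzM, hzt, hzx⟩ := exists_rep hW hw0 hwM h1 h2
  refine ⟨z, fun q _ => hz0 q, fun t _ => hzx t, fun x _ => (hzt x).monotoneOn _, ?_,
    fun q _ => abs_le.2 ⟨hzM q, (hz0 q).trans hM0⟩⟩
  intro ξ hξ hξ0 hξs _ ε hε a ha t ht x hx
  obtain ⟨hκ, hκc, hκ0, hκs⟩ := mollK_props ξ hξ hξ0 hξs ε hε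
  rw [stMollify_eq_cv, stMollify_eq_cv, cv_congr_ae hzζ]
  set κ := mollK ξ ε
  have hG := cv_contDiff hW.loc hκ hκc
  set G := cv ζ κ
  rw [deriv_slice hG]
  simp only [fderiv_slice hG]
  simp only [fun j => fderiv_slice (dv_contDiff hG (0, EuclideanSpace.single j 1)) t x]
  have hpsd : ∀ v : Fin d → ℝ, 0 ≤ ∑ i, ∑ j, v i * v j *
      dv (dv G (0, EuclideanSpace.single j 1)) (0, EuclideanSpace.single i 1) (t, x) := by
    intro v
    rw [quad_expand hG]
    exact h2 κ hκ hκc hκ0 (t, x) (fun s hs => (hκs t ht x hx s hs).2) _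
  by_cases hdet : a.det = 0
  · rw [hdet, Real.zero_rpow (by positivity), mul_zero, zero_mul]
    exact add_nonneg (h1 κ hκ hκc hκ0 (t, x)) (psd_pair' a ha
      (fun i j => dv (dv G (0, EuclideanSpace.single j 1)) (0, EuclideanSpace.single i 1) (t, x)) hpsd)
  · obtain ⟨B, lam, hB, hlam, hprod, hH⟩ := hlat a ha hdet
    have hdet0 : 0 ≤ a.det := ha.det_nonneg
    have hmain := h3 κ hκ hκc hκ0 (t, x) (hκs t ht x hx) B hB lam hlam
      (c ^ (((d : ℝ) + 1)⁻¹) * a.det ^ (((d : ℝ) + 1)⁻¹)) (by positivity)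
      (by rw [mul_pow, hroot _ hc.le, hroot _ hdet0]; exact hprod)
    have hHH := hH (fun i j => dv (dv G (0, EuclideanSpace.single j 1)) (0, EuclideanSpace.single i 1) (t, x)) hpsd
    simp only [fun i => quad_expand hG (t, x) (fun j => (B i j : ℝ))] at hHH
    refine hmain.trans ?_
    have e : ∀ i, lv (B i) = WithLp.toLp 2 (fun j => (B i j : ℝ)) := fun i => rfl
    simp only [e]
    linarith
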